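/- Assume X is a polyhedron, the functions {x ↦ exp(αᵀx)}_{α∈𝒜} are linearly independent on X, and Λ_X(𝒜) is nonempty. Then the X-SAGE cone is the finite Minkowski sum C_X(𝒜) = Σ_{λ ∈ Λ*_X(𝒜)} C_X(𝒜,λ) over the (finitely many) reduced normalized X-circuits. -/

import Mathlib

open Finset

/-- Dot product on `Fin n → ℝ`. -/
noncomputable def dotp {n : ℕ} (y x : Fin n → ℝ) : ℝ := ∑ i, y i * x i

/-- Support function `σ_X : ℝⁿ → ℝ ∪ {±∞}` of a set `X ⊆ ℝⁿ`. -/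
noncomputable def suppFn {n : ℕ} (X : Set (Fin n → ℝ)) (y : Fin n → ℝ) : EReal :=
  ⨆ x ∈ X, ((dotp y x : ℝ) : EReal)

/-- The linear map `𝒜 : ℝ^𝒜 → ℝⁿ`, `ν ↦ Σ_α ν_α α`. -/
noncomputable def Amap {n m : ℕ} (A : Fin m → Fin n → ℝ) (ν : Fin m → ℝ) : Fin n → ℝ :=
  fun j => ∑ i, ν i * A i j

/-- `N_β = {ν : ν_α ≥ 0 (α ≠ β), Σ ν_α = 0}`. -/
def Nbeta {m : ℕ} (b : Fin m) : Set (Fin m → ℝ) :=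
  {ν | (∀ i, i ≠ b → 0 ≤ ν i) ∧ ∑ i, ν i = 0}

/-- Two vectors are proportional if one is a scalar multiple of the other. -/
def Proportional {m : ℕ} (u v : Fin m → ℝ) : Prop :=
  ∃ t : ℝ, u = t • v ∨ v = t • u

/-- The augmented support function `ν ↦ σ_X(-𝒜ν)`. -/
noncomputable def sigA {n m : ℕ} (X : Set (Fin n → ℝ)) (A : Fin m → Fin n → ℝ)
    (ν : Fin m → ℝ) : EReal :=
  suppFn X (-(Amap A ν))

/-- The map `ν ↦ σ_X(-𝒜ν)` is affine on the segment `[ν1, ν2]`. -/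
def SigmaAffineOnSeg {n m : ℕ} (X : Set (Fin n → ℝ)) (A : Fin m → Fin n → ℝ)
    (ν1 ν2 : Fin m → ℝ) : Prop :=
  ∀ t : ℝ, t ∈ Set.Icc (0:ℝ) 1 →
    sigA X A (t • ν1 + (1 - t) • ν2) =
      (t : EReal) * sigA X A ν1 + ((1 - t : ℝ) : EReal) * sigA X A ν2

/-- `ν` is an `X`-circuit of `𝒜` (with negative index allowed only at `b`). -/
def IsXCircuit {n m : ℕ} (X : Set (Fin n → ℝ)) (A : Fin m → Fin n → ℝ)
    (b : Fin m) (ν : Fin m → ℝ) : Prop :=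
  ν ∈ Nbeta b ∧ ν ≠ 0 ∧ sigA X A ν < ⊤ ∧
  ¬ ∃ (ν1 ν2 : Fin m → ℝ) (θ : ℝ), ν1 ∈ Nbeta b ∧ ν2 ∈ Nbeta b ∧
      ¬ Proportional ν1 ν2 ∧ θ ∈ Set.Ioo (0:ℝ) 1 ∧
      ν = θ • ν1 + (1 - θ) • ν2 ∧ SigmaAffineOnSeg X A ν1 ν2

/-- All finite nonnegative combinations of elements of `S` (including `0`). -/
def coneHull {E : Type*} [AddCommMonoid E] [SMul ℝ E] (S : Set E) : Set E :=
  {x | ∃ (k : ℕ) (t : Fin k → ℝ) (v : Fin k → E),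
    (∀ j, 0 ≤ t j) ∧ (∀ j, v j ∈ S) ∧ x = ∑ j, t j • v j}

/-- `v` is an edge generator of the convex cone `K`. -/
def IsEdgeGenerator {E : Type*} [AddCommMonoid E] [SMul ℝ E] (K : Set E) (v : E) : Prop :=
  v ≠ 0 ∧ v ∈ K ∧ ∀ u ∈ K, ∀ w ∈ K, v = u + w →
    (∃ a : ℝ, 0 ≤ a ∧ u = a • v) ∧ (∃ b : ℝ, 0 ≤ b ∧ w = b • v)

/-- The `X`-AGE cone `C_X(𝒜, β)`, as a cone of coefficient vectors. -/
def AgeCone {n m : ℕ} (X : Set (Fin n → ℝ)) (A : Fin m → Fin n → ℝ) (b : Fin m) :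
    Set (Fin m → ℝ) :=
  {c | (∀ i, i ≠ b → 0 ≤ c i) ∧ ∀ x ∈ X, 0 ≤ ∑ i, c i * Real.exp (dotp (A i) x)}

/-- The `X`-SAGE cone `C_X(𝒜) = Σ_β C_X(𝒜, β)`. -/
def Sage {n m : ℕ} (X : Set (Fin n → ℝ)) (A : Fin m → Fin n → ℝ) : Set (Fin m → ℝ) :=
  {c | ∃ f : Fin m → (Fin m → ℝ), (∀ b, f b ∈ AgeCone X A b) ∧ c = ∑ b, f b}

/-- One summand of the relative entropy, with the conventions `0·log 0 = 0` and
`D = ∞` if `a > 0` while `c ≤ 0`. -/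
noncomputable def relEnt (a c : ℝ) : EReal :=
  if a = 0 then 0 else if 0 < c then ((a * Real.log (a / c) : ℝ) : EReal) else ⊤

/-- The relative entropy `D(ν_{∖β}, e · c_{∖β})`. -/
noncomputable def relEntSum {m : ℕ} (b : Fin m) (ν c : Fin m → ℝ) : EReal :=
  ∑ i ∈ Finset.univ.erase b, relEnt (ν i) (Real.exp 1 * c i)

/-- Condition (★): `ν ∈ N_β`, `ν ≠ 0`, `σ_X(-𝒜ν) + D(ν_{∖β}, e c_{∖β}) ≤ c_β`. -/
def StarCond {n m : ℕ} (X : Set (Fin n → ℝ)) (A : Fin m → Fin n → ℝ)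
    (b : Fin m) (c ν : Fin m → ℝ) : Prop :=
  ν ∈ Nbeta b ∧ ν ≠ 0 ∧ sigA X A ν + relEntSum b ν c ≤ (c b : EReal)

/-- The `λ`-witnessed AGE cone `C_X(𝒜, λ)` for a normalized `λ` with `λ_β = -1`. -/
noncomputable def WitnessCone {n m : ℕ} (X : Set (Fin n → ℝ)) (A : Fin m → Fin n → ℝ)
    (b : Fin m) (l : Fin m → ℝ) : Set (Fin m → ℝ) :=
  {c | (∀ i, i ≠ b → 0 ≤ c i) ∧
    (-(c b)) * Real.exp ((sigA X A l).toReal) ≤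
      ∏ i ∈ Finset.univ.filter (fun i => 0 < l i), (c i / l i) ^ (l i)}

/-- Normalized `X`-circuits in `N_β`. -/
def LambdaB {n m : ℕ} (X : Set (Fin n → ℝ)) (A : Fin m → Fin n → ℝ) (b : Fin m) :
    Set (Fin m → ℝ) :=
  {l | IsXCircuit X A b l ∧ l b = -1}

/-- All normalized `X`-circuits of `𝒜`. -/
def Lambda {n m : ℕ} (X : Set (Fin n → ℝ)) (A : Fin m → Fin n → ℝ) : Set (Fin m → ℝ) :=
  ⋃ b, LambdaB X A b

/-- Functional form `φ_λ = (λ, σ_X(-𝒜λ)) ∈ ℝ^𝒜 × ℝ`. -/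
noncomputable def phiVec {n m : ℕ} (X : Set (Fin n → ℝ)) (A : Fin m → Fin n → ℝ)
    (l : Fin m → ℝ) : (Fin m → ℝ) × ℝ :=
  (l, (sigA X A l).toReal)

/-- Functional form as an affine function `φ_λ(y) = Σ y_α λ_α + σ_X(-𝒜λ)`. -/
noncomputable def phiFun {n m : ℕ} (X : Set (Fin n → ℝ)) (A : Fin m → Fin n → ℝ)
    (l : Fin m → ℝ) (y : Fin m → ℝ) : ℝ :=
  (∑ i, y i * l i) + (sigA X A l).toReal

/-- The circuit graph `G_X(𝒜)`. -/
noncomputable def circuitGraph {n m : ℕ} (X : Set (Fin n → ℝ)) (A : Fin m → Fin n → ℝ) :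
    Set ((Fin m → ℝ) × ℝ) :=
  coneHull ((phiVec X A '' Lambda X A) ∪ {((0 : Fin m → ℝ), (1 : ℝ))})

/-- The reduced normalized `X`-circuits `Λ*_X(𝒜)`. -/
noncomputable def LambdaStar {n m : ℕ} (X : Set (Fin n → ℝ)) (A : Fin m → Fin n → ℝ) :
    Set (Fin m → ℝ) :=
  {l | l ∈ Lambda X A ∧ IsEdgeGenerator (circuitGraph X A) (phiVec X A l)}

/-- `λ`-witnessed AGE cone for a normalized circuit, with `β` recovered from `λ`. -/
noncomputable def WitnessConeL {n m : ℕ} (X : Set (Fin n → ℝ)) (A : Fin m → Fin n → ℝ)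
    (l : Fin m → ℝ) : Set (Fin m → ℝ) :=
  ⋃ b ∈ {b : Fin m | l b = -1}, WitnessCone X A b l

/-- Dual cone of a set of coefficient vectors in `ℝ^𝒜`. -/
def dualConeV {m : ℕ} (K : Set (Fin m → ℝ)) : Set (Fin m → ℝ) :=
  {v | ∀ c ∈ K, 0 ≤ ∑ i, v i * c i}

/-- Dual cone of a subset of `ℝ^𝒜 × ℝ`. -/
def dualConeP {m : ℕ} (K : Set ((Fin m → ℝ) × ℝ)) : Set ((Fin m → ℝ) × ℝ) :=
  {p | ∀ q ∈ K, 0 ≤ (∑ i, p.1 i * q.1 i) + p.2 * q.2}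

/-- The basis functions `x ↦ exp(αᵀx)`, `α ∈ 𝒜`, are linearly independent on `X`. -/
def ExpLinIndep {n m : ℕ} (X : Set (Fin n → ℝ)) (A : Fin m → Fin n → ℝ) : Prop :=
  LinearIndependent ℝ (fun i : Fin m => fun x : X => Real.exp (dotp (A i) (x : Fin n → ℝ)))

/-- `X` is a polyhedron: an intersection of finitely many closed halfspaces. -/
def IsPolyhedron {n : ℕ} (X : Set (Fin n → ℝ)) : Prop :=
  ∃ (k : ℕ) (a : Fin k → Fin n → ℝ) (bb : Fin k → ℝ),
    X = {x | ∀ i, dotp (a i) x ≤ bb i}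

/-- Minkowski sum `Σ_{l ∈ Λ} C(l)` (finite sums, one summand per `l`;
the empty sum gives `{0}`). -/
def MinkSumOver {m : ℕ} (Λ : Set (Fin m → ℝ)) (C : (Fin m → ℝ) → Set (Fin m → ℝ)) :
    Set (Fin m → ℝ) :=
  {c | ∃ (s : Finset (Fin m → ℝ)) (f : (Fin m → ℝ) → (Fin m → ℝ)),
    (↑s ⊆ Λ) ∧ (∀ l ∈ s, f l ∈ C l) ∧ c = ∑ l ∈ s, f l}


section Cones

variable {E : Type*} [AddCommGroup E] [Module ℝ E]

theorem hull_induction {S : Set E} {p : E → Prop} (mem : ∀ x ∈ S, p x) (zero : p 0)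
    (add : ∀ x y, p x → p y → p (x + y)) (smul : ∀ (a : ℝ) (x : E), 0 ≤ a → p x → p (a • x))
    {x : E} (hx : x ∈ PointedCone.hull ℝ S) : p x := by
  induction hx using Submodule.span_induction with
  | mem x h => exact mem x h
  | zero => exact zero
  | add x y _ _ hx hy => exact add x y hx hy
  | smul a x _ hx => exact smul a x a.2 hx

theorem coneHull_eq_hull (S : Set E) : coneHull S = (PointedCone.hull ℝ S : Set E) := by
  apply Set.Subset.antisymm
  · rintro x ⟨k, t, v, ht, hv, rfl⟩
    exact sum_mem fun j _ => PointedCone.smul_mem _ (ht j) (PointedCone.subset_hull (hv j))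
  · intro x hx
    refine hull_induction (p := fun x => x ∈ coneHull S) ?_ ?_ ?_ ?_ hx
    · intro x hx
      exact ⟨1, fun _ => 1, fun _ => x, by simp, by simp [hx], by simp⟩
    · exact ⟨0, Fin.elim0, Fin.elim0, fun j => j.elim0, fun j => j.elim0, by simp⟩
    · rintro x y ⟨k, t, v, ht, hv, rfl⟩ ⟨k', t', v', ht', hv', rfl⟩
      refine ⟨k + k', Fin.append t t', Fin.append v v', ?_, ?_, ?_⟩
      · intro j
        refine Fin.addCases (fun i => ?_) (fun i => ?_) j
        · simpa using ht i
        · simpa using ht' i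
      · intro j
        refine Fin.addCases (fun i => ?_) (fun i => ?_) j
        · simpa using hv i
        · simpa using hv' i
      · simp [Fin.sum_univ_add]
    · rintro a x ha ⟨k, t, v, ht, hv, rfl⟩
      exact ⟨k, fun j => a * t j, v, fun j => mul_nonneg ha (ht j), hv, by
        simp [Finset.smul_sum, mul_smul]⟩

/-- Membership in the hull of a finite set, in terms of explicit coefficients. -/
theorem mem_hull_finset {S : Finset E} {x : E} (hx : x ∈ PointedCone.hull ℝ (S : Set E)) :
    ∃ t : E → ℝ, (∀ s, 0 ≤ t s) ∧ x = ∑ s ∈ S, t s • s := by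
  classical
  refine hull_induction (p := fun x => ∃ t : E → ℝ, (∀ s, 0 ≤ t s) ∧ x = ∑ s ∈ S, t s • s)
    ?_ ?_ ?_ ?_ hx
  · intro x hx
    refine ⟨fun s => if s = x then 1 else 0, fun s => by dsimp only; split_ifs <;> norm_num, ?_⟩
    simp [ite_smul, Finset.mem_coe.1 hx]
  · exact ⟨0, by simp, by simp⟩
  · rintro x y ⟨t, ht, rfl⟩ ⟨t', ht', rfl⟩
    exact ⟨t + t', fun s => add_nonneg (ht s) (ht' s), by
      simp [add_smul, Finset.sum_add_distrib]⟩
  · rintro a x ha ⟨t, ht, rfl⟩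
    exact ⟨fun s => a * t s, fun s => mul_nonneg ha (ht s), by simp [Finset.smul_sum, mul_smul]⟩

/-- **Farkas' lemma** for finitely many linear functionals. -/
theorem farkas {k : ℕ} {V : Type*} [AddCommGroup V] [Module ℝ V] (a : Fin k → V →ₗ[ℝ] ℝ)
    (b : V →ₗ[ℝ] ℝ) (h : ∀ x, (∀ i, a i x ≤ 0) → b x ≤ 0) :
    ∃ t : Fin k → ℝ, (∀ i, 0 ≤ t i) ∧ b = ∑ i, t i • a i := by
  induction k generalizing b with
  | zero =>
    refine ⟨Fin.elim0, fun i => i.elim0, ?_⟩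
    ext x
    have h1 := h x (fun i => i.elim0)
    have h2 := h (-x) (fun i => i.elim0)
    simp only [map_neg] at h2
    simp only [Finset.univ_eq_empty, Finset.sum_empty, LinearMap.zero_apply]
    linarith
  | succ k ih =>
    by_cases hc : ∀ x, (∀ i : Fin k, a i.castSucc x ≤ 0) → b x ≤ 0
    · obtain ⟨t, ht, hb⟩ := ih (fun i => a i.castSucc) b hc
      refine ⟨Fin.snoc t 0, ?_, ?_⟩
      · intro i
        refine Fin.lastCases ?_ (fun i => ?_) i
        · simp
        · simpa using ht i
      · simp [Fin.sum_univ_castSucc, hb]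
    · push Not at hc
      obtain ⟨x₁, hx₁, hbx₁⟩ := hc
      have hlast : 0 < a (Fin.last k) x₁ := by
        by_contra! hle
        refine absurd (h x₁ fun i => ?_) (not_le.2 hbx₁)
        exact Fin.lastCases hle hx₁ i
      obtain ⟨x₀, hx₀, hb₀, h₀⟩ : ∃ x₀, (∀ i : Fin k, a i.castSucc x₀ ≤ 0) ∧ 0 < b x₀ ∧
          a (Fin.last k) x₀ = 1 := by
        refine ⟨(a (Fin.last k) x₁)⁻¹ • x₁, fun i => ?_, ?_, ?_⟩
        · rw [map_smul, smul_eq_mul]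
          exact mul_nonpos_of_nonneg_of_nonpos (inv_nonneg.2 hlast.le) (hx₁ i)
        · rw [map_smul, smul_eq_mul]; positivity
        · rw [map_smul, smul_eq_mul, inv_mul_cancel₀ hlast.ne']
      obtain ⟨t, ht, hb⟩ := ih (fun i => a i.castSucc - a i.castSucc x₀ • a (Fin.last k))
        (b - b x₀ • a (Fin.last k)) (by
          intro x hx
          have := h (x - a (Fin.last k) x • x₀) (by
            intro i
            refine Fin.lastCases ?_ (fun i => ?_) i
            · simp [h₀]
            · have := hx i
              simp only [LinearMap.sub_apply, LinearMap.smul_apply, smul_eq_mul] at this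
              simp only [map_sub, map_smul, smul_eq_mul]
              linarith)
          simp only [map_sub, map_smul, smul_eq_mul] at this
          simp only [LinearMap.sub_apply, LinearMap.smul_apply, smul_eq_mul]
          linarith)
      refine ⟨Fin.snoc t (b x₀ - ∑ i, t i * a i.castSucc x₀), ?_, ?_⟩
      · intro i
        refine Fin.lastCases ?_ (fun i => ?_) i
        · have : ∑ i, t i * a i.castSucc x₀ ≤ 0 :=
            Finset.sum_nonpos fun i _ => mul_nonpos_of_nonneg_of_nonpos (ht i) (hx₀ i)
          simp only [Fin.snoc_last]
          linarith
        · simpa using ht i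
      · rw [sub_eq_iff_eq_add] at hb
        generalize b x₀ = β at hb ⊢
        rw [hb]
        ext x
        simp only [LinearMap.add_apply, LinearMap.sum_apply, LinearMap.smul_apply,
          LinearMap.sub_apply, smul_eq_mul, mul_sub, Finset.sum_sub_distrib,
          Fin.sum_univ_castSucc, Fin.snoc_castSucc, Fin.snoc_last, sub_mul, Finset.sum_mul,
          mul_assoc]
        ring

/-- Cutting a finitely generated cone by a halfspace leaves it finitely generated. -/
theorem fg_inf_halfspace (S : Finset E) (f : E →ₗ[ℝ] ℝ) :
    ∃ T : Finset E, ∀ x, x ∈ PointedCone.hull ℝ (T : Set E) ↔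
      x ∈ PointedCone.hull ℝ (S : Set E) ∧ 0 ≤ f x := by
  classical
  let P := S.filter fun s => 0 ≤ f s
  let N := S.filter fun s => f s < 0
  let T := P ∪ (P ×ˢ N).image fun pq => f pq.1 • pq.2 - f pq.2 • pq.1
  have hPT : PointedCone.hull ℝ (P : Set E) ≤ PointedCone.hull ℝ (T : Set E) :=
    Submodule.span_mono (by simp [T])
  have hPf : ∀ p ∈ PointedCone.hull ℝ (P : Set E), 0 ≤ f p := fun p hp =>
    hull_induction (p := fun p => 0 ≤ f p) (fun x hx => (Finset.mem_filter.1 hx).2) (by simp)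
      (fun x y hx hy => by simpa using add_nonneg hx hy)
      (fun a x ha hx => by simpa using mul_nonneg ha hx) hp
  have hNf : ∀ q ∈ PointedCone.hull ℝ (N : Set E), f q < 0 ∨ q = 0 := fun q hq =>
    hull_induction (p := fun q => f q < 0 ∨ q = 0)
      (fun x hx => Or.inl (Finset.mem_filter.1 hx).2) (by simp)
      (fun x y hx hy => by
        rcases hx with hx | rfl
        · rcases hy with hy | rfl
          · left; rw [map_add]; linarith
          · left; simpa using hx
        · simpa using hy)
      (fun a x ha hx => by
        rcases ha.eq_or_lt with rfl | ha
        · simp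
        · rcases hx with hx | rfl
          · left; simpa using mul_neg_of_pos_of_neg ha hx
          · simp) hq
  have hPN : ∀ p ∈ PointedCone.hull ℝ (P : Set E), ∀ q ∈ PointedCone.hull ℝ (N : Set E),
      f p • q - f q • p ∈ PointedCone.hull ℝ (T : Set E) := by
    intro p hp
    refine fun q hq => hull_induction
      (p := fun q => f p • q - f q • p ∈ PointedCone.hull ℝ (T : Set E)) ?_ (by simp) ?_ ?_ hq
    · intro q hq
      refine hull_induction
        (p := fun p => f p • q - f q • p ∈ PointedCone.hull ℝ (T : Set E)) ?_ (by simp) ?_ ?_ hp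
      · intro p hp
        apply PointedCone.subset_hull
        simp only [T, Finset.coe_union, Finset.coe_image]
        exact Or.inr ⟨(p, q), by simpa using ⟨hp, hq⟩, rfl⟩
      · intro x y hx hy
        convert add_mem hx hy using 1
        simp only [map_add, add_smul, smul_add]
        abel
      · intro a x ha hx
        convert PointedCone.smul_mem _ ha hx using 1
        simp only [map_smul, smul_eq_mul, smul_sub, smul_smul, mul_comm]
    · intro x y hx hy
      convert add_mem hx hy using 1
      simp only [map_add, add_smul, smul_add]
      abel
    · intro a x ha hx
      convert PointedCone.smul_mem _ ha hx using 1
      simp only [map_smul, smul_eq_mul, smul_sub, smul_smul, mul_comm]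
  refine ⟨T, fun x => ⟨fun hx => ?_, ?_⟩⟩
  · refine hull_induction
      (p := fun x => x ∈ PointedCone.hull ℝ (S : Set E) ∧ 0 ≤ f x) ?_ (by simp) ?_ ?_ hx
    · intro x hx
      simp only [T, Finset.coe_union, Finset.coe_image] at hx
      rcases hx with hx | ⟨⟨p, q⟩, hpq, rfl⟩
      · exact ⟨PointedCone.subset_hull (Finset.mem_filter.1 hx).1, (Finset.mem_filter.1 hx).2⟩
      · have hpq := Finset.mem_product.1 (Finset.mem_coe.1 hpq)
        obtain ⟨hpS, hp⟩ := Finset.mem_filter.1 hpq.1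
        obtain ⟨hqS, hq⟩ := Finset.mem_filter.1 hpq.2
        simp only at hp hq hpS hqS ⊢
        constructor
        · rw [sub_eq_add_neg, ← neg_smul]
          exact add_mem (PointedCone.smul_mem _ hp (PointedCone.subset_hull hqS))
            (PointedCone.smul_mem _ (by linarith) (PointedCone.subset_hull hpS))
        · simp only [map_sub, map_smul, smul_eq_mul]
          exact le_of_eq (by ring)
    · exact fun x y hx hy => ⟨add_mem hx.1 hy.1, by simpa using add_nonneg hx.2 hy.2⟩
    · exact fun a x ha hx => ⟨PointedCone.smul_mem _ ha hx.1, by simpa using mul_nonneg ha hx.2⟩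
  · rintro ⟨hx, hfx⟩
    have hSPN : (S : Set E) = (P : Set E) ∪ (N : Set E) := by
      ext s
      simp only [P, N, Finset.coe_filter, Set.mem_union, Set.mem_ofPred_eq, Finset.mem_coe]
      rcases le_or_gt 0 (f s) with h | h <;> simp [h]
    rw [hSPN, PointedCone.hull, Submodule.span_union, Submodule.mem_sup] at hx
    obtain ⟨p, hp, q, hq, rfl⟩ := hx
    rw [map_add] at hfx
    rcases hNf q hq with hq' | rfl
    · have hfp : 0 < f p := by linarith
      have : p + q = (f p)⁻¹ • ((f p • q - f q • p) + (f p + f q) • p) := by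
        rw [add_smul, smul_add, smul_sub, smul_add, smul_smul, smul_smul, smul_smul,
          inv_mul_cancel₀ hfp.ne']
        module
      rw [this]
      exact PointedCone.smul_mem _ (inv_nonneg.2 hfp.le)
        (add_mem (hPN p hp q hq) (PointedCone.smul_mem _ hfx (hPT hp)))
    · simpa using hPT hp

/-- **Weyl's theorem**: a polyhedral cone in a finite dimensional space is finitely generated. -/
theorem polyhedral_cone_fg [Module.Finite ℝ E] {ι : Type*} (s : Finset ι)
    (f : ι → E →ₗ[ℝ] ℝ) :
    ∃ T : Finset E, ∀ x, x ∈ PointedCone.hull ℝ (T : Set E) ↔ ∀ i ∈ s, 0 ≤ f i x := by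
  classical
  induction s using Finset.induction_on with
  | empty =>
    obtain ⟨T, hT⟩ := (Module.Finite.fg_top : (⊤ : Submodule {c : ℝ // 0 ≤ c} E).FG)
    exact ⟨T, fun x => by simp [PointedCone.hull, hT]⟩
  | insert i s _ ih =>
    obtain ⟨S, hS⟩ := ih
    obtain ⟨T, hT⟩ := fg_inf_halfspace S (f i)
    exact ⟨T, fun x => by rw [hT, hS]; simp [and_comm]⟩

/-- A finitely generated salient cone is generated by edge generators taken from any finite
generating set. -/
theorem exists_edge_generators (S : Finset E)
    (hsal : ∀ u ∈ PointedCone.hull ℝ (S : Set E), ∀ w ∈ PointedCone.hull ℝ (S : Set E),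
      u + w = 0 → u = 0) :
    ∃ T ⊆ S, PointedCone.hull ℝ (T : Set E) = PointedCone.hull ℝ (S : Set E) ∧
      ∀ v ∈ T, IsEdgeGenerator (PointedCone.hull ℝ (S : Set E) : Set E) v := by
  classical
  obtain ⟨T, hT, hmin⟩ := Finset.exists_min_image
    (S.powerset.filter fun T : Finset E => PointedCone.hull ℝ (T : Set E) = PointedCone.hull ℝ (S : Set E))
    Finset.card ⟨S, by simp⟩
  simp only [Finset.mem_filter, Finset.mem_powerset] at hT hmin
  obtain ⟨hTS, hTeq⟩ := hT
  refine ⟨T, hTS, hTeq, fun v hv => ?_⟩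
  have hirr : v ∉ PointedCone.hull ℝ ((T.erase v : Finset E) : Set E) := by
    intro hmem
    refine absurd (hmin (T.erase v) ⟨(Finset.erase_subset _ _).trans hTS, ?_⟩)
      (not_le.2 (Finset.card_erase_lt_of_mem hv))
    rw [← hTeq]
    refine le_antisymm (Submodule.span_mono (by simp)) (Submodule.span_le.2 fun t ht => ?_)
    by_cases h : t = v
    · exact h ▸ hmem
    · exact PointedCone.subset_hull (by simpa [h] using ht)
  have hrest : ∀ t : E → ℝ, (∀ s, 0 ≤ t s) →
      ∑ s ∈ T.erase v, t s • s ∈ PointedCone.hull ℝ ((T.erase v : Finset E) : Set E) :=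
    fun t ht => sum_mem fun s hs => PointedCone.smul_mem _ (ht s) (PointedCone.subset_hull hs)
  rw [← hTeq] at hsal ⊢
  have hle : PointedCone.hull ℝ ((T.erase v : Finset E) : Set E) ≤
      PointedCone.hull ℝ (T : Set E) := Submodule.span_mono (by simp)
  have hvT : v ∈ PointedCone.hull ℝ (T : Set E) := PointedCone.subset_hull hv
  refine ⟨?_, hvT, ?_⟩
  · rintro rfl
    exact hirr (zero_mem _)
  · intro u hu w hw huw
    obtain ⟨t, ht, rfl⟩ := mem_hull_finset hu
    obtain ⟨t', ht', rfl⟩ := mem_hull_finset hw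
    rw [← Finset.add_sum_erase _ _ hv, ← Finset.add_sum_erase _ _ hv] at huw
    set r := ∑ s ∈ T.erase v, t s • s with hr
    set r' := ∑ s ∈ T.erase v, t' s • s with hr'
    have hrr : r + r' ∈ PointedCone.hull ℝ ((T.erase v : Finset E) : Set E) :=
      add_mem (hrest t ht) (hrest t' ht')
    have hkey : (1 - t v - t' v) • v = r + r' := by
      rw [sub_smul, sub_smul, one_smul]
      nth_rw 1 [huw]
      abel
    have hcoef : 1 - t v - t' v ≤ 0 := by
      by_contra! hpos
      apply hirr
      have : (1 - t v - t' v)⁻¹ • (r + r') = v := by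
        rw [← hkey, smul_smul, inv_mul_cancel₀ hpos.ne', one_smul]
      simpa only [this] using PointedCone.smul_mem _ (inv_nonneg.2 hpos.le) hrr
    have hz : r + r' = 0 := by
      refine hsal _ (hle hrr) ((-(1 - t v - t' v)) • v)
        (PointedCone.smul_mem _ (by linarith) hvT) ?_
      rw [← hkey, ← add_smul, add_neg_cancel, zero_smul]
    have hr0 : r = 0 := hsal _ (hle (hrest t ht)) _ (hle (hrest t' ht')) hz
    have hr0' : r' = 0 := by simpa [hr0] using hz
    rw [← Finset.add_sum_erase _ _ hv, ← Finset.add_sum_erase _ _ hv, ← hr, ← hr', hr0, hr0']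
    exact ⟨⟨t v, ht v, by simp⟩, ⟨t' v, ht' v, by simp⟩⟩

/-- Every edge generator of a finitely generated cone is a positive multiple of a generator. -/
theorem IsEdgeGenerator.exists_smul_mem {S : Finset E} {v : E}
    (hv : IsEdgeGenerator (PointedCone.hull ℝ (S : Set E) : Set E) v) :
    ∃ s ∈ S, ∃ r : ℝ, 0 < r ∧ v = r • s := by
  classical
  obtain ⟨hv0, hvS, hedge⟩ := hv
  obtain ⟨t, ht, hvt⟩ := mem_hull_finset hvS
  obtain ⟨s, hs, hts⟩ : ∃ s ∈ S, t s • s ≠ 0 := by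
    by_contra! h
    exact hv0 (hvt.trans (Finset.sum_eq_zero h))
  obtain ⟨⟨a, ha, hav⟩, -⟩ := hedge (t s • s)
    (PointedCone.smul_mem _ (ht s) (PointedCone.subset_hull hs)) (∑ s ∈ S.erase s, t s • s)
    (sum_mem fun s hs => PointedCone.smul_mem _ (ht s)
      (PointedCone.subset_hull (Finset.mem_of_mem_erase hs)))
    (hvt.trans (Finset.add_sum_erase S (fun s => t s • s) hs).symm)
  have hane : a ≠ 0 := by
    rintro rfl
    exact hts (by simpa using hav)
  have htne : t s ≠ 0 := by
    intro h
    exact hts (by simp [h])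
  refine ⟨s, hs, a⁻¹ * t s, mul_pos (inv_pos.2 (lt_of_le_of_ne ha hane.symm))
    (lt_of_le_of_ne (ht s) htne.symm), ?_⟩
  rw [mul_smul, hav, smul_smul, inv_mul_cancel₀ hane, one_smul]

end Cones

section Epigraph

/-- The linear functional `p ↦ Σ p.1 i * w i + p.2 * t` on `ℝ^k × ℝ`. -/
noncomputable def pairFn {k : ℕ} (w : Fin k → ℝ) (t : ℝ) : ((Fin k → ℝ) × ℝ) →ₗ[ℝ] ℝ where
  toFun p := ∑ i, p.1 i * w i + p.2 * t
  map_add' p q := by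
    simp only [Prod.fst_add, Prod.snd_add, Pi.add_apply, add_mul, Finset.sum_add_distrib]
    ring
  map_smul' c p := by
    simp only [Prod.smul_fst, Prod.smul_snd, Pi.smul_apply, smul_eq_mul, RingHom.id_apply,
      mul_add, Finset.mul_sum, mul_assoc]

theorem pairFn_apply {k : ℕ} (w : Fin k → ℝ) (t : ℝ) (p : (Fin k → ℝ) × ℝ) :
    pairFn w t p = ∑ i, p.1 i * w i + p.2 * t := rfl

variable {n m : ℕ} {X : Set (Fin n → ℝ)} {A : Fin m → Fin n → ℝ}

theorem dotp_neg_left (y x : Fin n → ℝ) : dotp (-y) x = -dotp y x := by simp [dotp]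

theorem dotp_smul_right (c : ℝ) (y x : Fin n → ℝ) : dotp y (c • x) = c * dotp y x := by
  simp only [dotp, Pi.smul_apply, smul_eq_mul, Finset.mul_sum]
  exact Finset.sum_congr rfl fun i _ => by ring

theorem dotp_add_right (y x x' : Fin n → ℝ) : dotp y (x + x') = dotp y x + dotp y x' := by
  simp [dotp, mul_add, Finset.sum_add_distrib]

theorem dotp_sub_left (y y' x : Fin n → ℝ) : dotp (y - y') x = dotp y x - dotp y' x := by
  simp [dotp, sub_mul]

theorem dotp_eq_pairFn (y x : Fin n → ℝ) (s t : ℝ) : dotp y x + s * t = pairFn y s (x, t) := by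
  simp only [dotp, pairFn_apply]
  rw [mul_comm s t]
  congr 1
  exact Finset.sum_congr rfl fun i _ => mul_comm _ _

theorem dotp_Amap (ν : Fin m → ℝ) (x : Fin n → ℝ) :
    dotp (Amap A ν) x = ∑ i, ν i * dotp (A i) x := by
  simp only [dotp, Amap, Finset.sum_mul, Finset.mul_sum]
  rw [Finset.sum_comm]
  exact Finset.sum_congr rfl fun i _ => Finset.sum_congr rfl fun j _ => by ring

theorem sigA_le_iff (ν : Fin m → ℝ) (s : ℝ) :
    sigA X A ν ≤ (s : EReal) ↔ ∀ x ∈ X, 0 ≤ ∑ i, ν i * dotp (A i) x + s := by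
  simp only [sigA, suppFn, iSup_le_iff, EReal.coe_le_coe_iff, dotp_neg_left, dotp_Amap]
  exact forall₂_congr fun x _ => by constructor <;> intro h <;> linarith

theorem sigA_ne_bot (hX : X.Nonempty) (ν : Fin m → ℝ) : sigA X A ν ≠ ⊥ := by
  obtain ⟨x, hx⟩ := hX
  exact ne_bot_of_le_ne_bot (EReal.coe_ne_bot (dotp (-(Amap A ν)) x))
    (le_iSup₂_of_le x hx le_rfl)

theorem coe_toReal_sigA (hX : X.Nonempty) {ν : Fin m → ℝ} (h : sigA X A ν < ⊤) :
    ((sigA X A ν).toReal : EReal) = sigA X A ν :=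
  EReal.coe_toReal h.ne (sigA_ne_bot hX ν)

/-- The epigraph of `ν ↦ σ_X(-𝒜ν)` over `N_β`. -/
noncomputable def epi (X : Set (Fin n → ℝ)) (A : Fin m → Fin n → ℝ) (b : Fin m) :
    PointedCone ℝ ((Fin m → ℝ) × ℝ) where
  carrier := {p | p.1 ∈ Nbeta b ∧ ∀ x ∈ X, 0 ≤ pairFn (fun i => dotp (A i) x) 1 p}
  add_mem' := by
    rintro p q ⟨⟨hp1, hp2⟩, hp3⟩ ⟨⟨hq1, hq2⟩, hq3⟩
    refine ⟨⟨fun i hi => add_nonneg (hp1 i hi) (hq1 i hi), ?_⟩, fun x hx => ?_⟩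
    · simp [Finset.sum_add_distrib, hp2, hq2]
    · rw [map_add]
      exact add_nonneg (hp3 x hx) (hq3 x hx)
  zero_mem' := ⟨⟨by simp, by simp⟩, by simp⟩
  smul_mem' := by
    rintro ⟨c, hc⟩ p ⟨⟨hp1, hp2⟩, hp3⟩
    change c • p ∈ _
    refine ⟨⟨fun i hi => mul_nonneg hc (hp1 i hi), ?_⟩, fun x hx => ?_⟩
    · simp [← Finset.mul_sum, hp2]
    · rw [map_smul]
      exact mul_nonneg hc (hp3 x hx)

theorem mem_epi {b : Fin m} {p : (Fin m → ℝ) × ℝ} :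
    p ∈ epi X A b ↔ p.1 ∈ Nbeta b ∧ ∀ x ∈ X, 0 ≤ pairFn (fun i => dotp (A i) x) 1 p := Iff.rfl

theorem mem_epi_iff_sigA_le {b : Fin m} {p : (Fin m → ℝ) × ℝ} :
    p ∈ epi X A b ↔ p.1 ∈ Nbeta b ∧ sigA X A p.1 ≤ (p.2 : EReal) := by
  simp [mem_epi, sigA_le_iff, pairFn_apply]

theorem phiVec_mem_epi (hX : X.Nonempty) {b : Fin m} {ν : Fin m → ℝ} (hν : ν ∈ Nbeta b)
    (h : sigA X A ν < ⊤) : phiVec X A ν ∈ epi X A b :=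
  mem_epi_iff_sigA_le.2 ⟨hν, (coe_toReal_sigA hX h).ge⟩

/-- An affine function is nonnegative on a polyhedron iff its homogenization is nonnegative on
a finite set of generators of the homogenized polyhedron. -/
theorem exists_homogenization (hX : X.Nonempty) (hpoly : IsPolyhedron X) :
    ∃ T : Finset ((Fin n → ℝ) × ℝ), ∀ (y : Fin n → ℝ) (s : ℝ),
      (∀ x ∈ X, 0 ≤ dotp y x + s) ↔ ∀ τ ∈ T, 0 ≤ dotp y τ.1 + s * τ.2 := by
  obtain ⟨k, a, bb, rfl⟩ := hpoly
  obtain ⟨T, hT⟩ := polyhedral_cone_fg (E := (Fin n → ℝ) × ℝ) Finset.univ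
    (fun o : Option (Fin k) => o.elim (pairFn 0 1) fun i => pairFn (-a i) (bb i))
  have hT' : ∀ p : (Fin n → ℝ) × ℝ, p ∈ PointedCone.hull ℝ (T : Set ((Fin n → ℝ) × ℝ)) ↔
      0 ≤ p.2 ∧ ∀ i, dotp (a i) p.1 ≤ bb i * p.2 := by
    intro p
    rw [hT]
    simp only [Finset.mem_univ, forall_true_left, Option.forall, Option.elim]
    refine and_congr (by simp [pairFn_apply]) (forall_congr' fun i => ?_)
    rw [← Prod.mk.eta (p := p), ← dotp_eq_pairFn, dotp_neg_left]
    constructor <;> intro h <;> simp only at h ⊢ <;> linarith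
  refine ⟨T, fun y s => ⟨fun h τ hτ => ?_, fun h x hx => ?_⟩⟩
  · obtain ⟨h0, hle⟩ := (hT' τ).1 (PointedCone.subset_hull hτ)
    rcases h0.eq_or_lt with h0 | h0
    · obtain ⟨x₀, hx₀⟩ := hX
      rw [← h0, mul_zero, add_zero]
      by_contra! hneg
      have key : ∀ r : ℝ, 0 ≤ r → 0 ≤ dotp y x₀ + r * dotp y τ.1 + s := by
        intro r hr
        have := h (x₀ + r • τ.1) (fun i => by
          rw [dotp_add_right, dotp_smul_right]
          have h1 := hx₀ i
          have h2 := hle i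
          rw [← h0, mul_zero] at h2
          have := mul_nonpos_of_nonneg_of_nonpos hr h2
          linarith)
        rwa [dotp_add_right, dotp_smul_right] at this
      have h1 := key 0 le_rfl
      have h2 := key ((dotp y x₀ + s + 1) / -dotp y τ.1) (by
        apply div_nonneg <;> linarith)
      have h3 : (dotp y x₀ + s + 1) / -dotp y τ.1 * dotp y τ.1 = -(dotp y x₀ + s + 1) := by
        rw [div_neg, neg_mul, div_mul_cancel₀ _ hneg.ne]
      rw [h3] at h2
      linarith
    · have := h (τ.2⁻¹ • τ.1) (fun i => by
        rw [dotp_smul_right, inv_mul_le_iff₀ h0, mul_comm]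
        exact hle i)
      rw [dotp_smul_right] at this
      have h2 : dotp y τ.1 + s * τ.2 = τ.2 * (τ.2⁻¹ * dotp y τ.1 + s) := by field_simp
      rw [h2]
      exact mul_nonneg h0.le this
  · have hmem : (x, (1 : ℝ)) ∈ PointedCone.hull ℝ (T : Set ((Fin n → ℝ) × ℝ)) :=
      (hT' _).2 ⟨zero_le_one, fun i => by simpa using hx i⟩
    have : 0 ≤ pairFn y s (x, 1) := by
      refine hull_induction (p := fun q => 0 ≤ pairFn y s q) ?_ (by simp) ?_ ?_ hmem
      · rintro ⟨x', t⟩ hq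
        rw [← dotp_eq_pairFn]
        exact h _ hq
      · intro p q hp hq
        rw [map_add]
        exact add_nonneg hp hq
      · intro c q hc hq
        rw [map_smul]
        exact mul_nonneg hc hq
    rwa [← dotp_eq_pairFn, mul_one] at this

theorem epi_fg (hX : X.Nonempty) (hpoly : IsPolyhedron X) (b : Fin m) :
    ∃ S : Finset ((Fin m → ℝ) × ℝ), PointedCone.hull ℝ (S : Set ((Fin m → ℝ) × ℝ)) =
      epi X A b := by
  classical
  obtain ⟨T, hT⟩ := exists_homogenization hX hpoly
  obtain ⟨S, hS⟩ := polyhedral_cone_fg (E := (Fin m → ℝ) × ℝ)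
    (((Finset.univ.erase b).image fun i => pairFn (Pi.single i 1) 0) ∪
      {pairFn (fun _ => 1) 0, pairFn (fun _ => -1) 0} ∪
      T.image fun τ => pairFn (fun i => dotp (A i) τ.1) τ.2) id
  refine ⟨S, SetLike.ext fun p => ?_⟩
  have hTp := hT (Amap A p.1) p.2
  simp only [dotp_Amap] at hTp
  rw [hS, mem_epi]
  simp only [Finset.mem_union, Finset.mem_image, Finset.mem_insert, Finset.mem_singleton, id,
    or_imp, forall_and, forall_exists_index, and_imp, forall_apply_eq_imp_iff₂, forall_eq,
    pairFn_apply, mul_one, mul_zero, add_zero, hTp, Finset.mem_erase, Finset.mem_univ, and_true]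
  refine and_congr ⟨fun h => ⟨fun i hi => ?_, ?_⟩, fun h => ⟨fun i hi => ?_, ?_⟩⟩ Iff.rfl
  · simpa [Pi.single_apply] using h.1 i hi
  · have h1 := h.2.1
    have h2 := h.2.2
    simp only [mul_neg, mul_one, Finset.sum_neg_distrib] at h1 h2
    linarith
  · simpa [Pi.single_apply] using h.1 i hi
  · simp [h.2]

/-- Theorem of alternatives: if `(z, 1)` is nonnegative on the epigraph over `N_β`, then some
point of the polyhedron `X` satisfies `(α - β)ᵀ x ≤ z_α - z_β` for all `α`. -/
theorem exists_point_of_nonneg_on_epi (hpoly : IsPolyhedron X) (b : Fin m) (z : Fin m → ℝ)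
    (h : ∀ p ∈ epi X A b, 0 ≤ pairFn z 1 p) :
    ∃ x ∈ X, ∀ i, dotp (A i) x - dotp (A b) x ≤ z i - z b := by
  classical
  obtain ⟨k, a, bb, rfl⟩ := hpoly
  by_contra! hno
  let F : Option (Fin k ⊕ Fin m) → ((Fin n → ℝ) × ℝ) →ₗ[ℝ] ℝ := fun o =>
    o.elim (pairFn 0 (-1)) fun j => j.elim (fun i => pairFn (a i) (-bb i))
      fun i => pairFn (A i - A b) (-(z i - z b))
  let e := Fintype.equivFin (Option (Fin k ⊕ Fin m))
  obtain ⟨t, ht, heq⟩ := farkas (fun j => F (e.symm j)) (pairFn 0 1) (by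
    rintro ⟨x, τ⟩ hx
    have hx' : ∀ o, F o (x, τ) ≤ 0 := fun o => by simpa using hx (e o)
    by_contra! hpos
    have hτ : 0 < τ := by simpa [pairFn_apply] using hpos
    obtain ⟨i, hi⟩ := hno (τ⁻¹ • x) (fun i => by
      have := hx' (some (Sum.inl i))
      simp only [F, Option.elim, Sum.elim_inl] at this
      rw [← dotp_eq_pairFn] at this
      rw [dotp_smul_right, inv_mul_le_iff₀ hτ]
      linarith)
    have := hx' (some (Sum.inr i))
    simp only [F, Option.elim, Sum.elim_inr] at this
    rw [← dotp_eq_pairFn, dotp_sub_left] at this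
    rw [dotp_smul_right, dotp_smul_right, ← mul_sub, lt_inv_mul_iff₀ hτ] at hi
    linarith)
  let μ : Fin k → ℝ := fun i => t (e (some (Sum.inl i)))
  let ν : Fin m → ℝ := fun i => t (e (some (Sum.inr i)))
  have hev : ∀ (x : Fin n → ℝ) (τ : ℝ), τ = -(t (e none) * τ) +
      (∑ i, μ i * (dotp (a i) x + -bb i * τ) +
        ∑ i, ν i * (dotp (A i) x - dotp (A b) x + -(z i - z b) * τ)) := by
    intro x τ
    have h1 := congrArg (fun f => f (x, τ)) heq
    simp only [LinearMap.sum_apply, LinearMap.smul_apply, smul_eq_mul] at h1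
    rw [← e.sum_comp, Fintype.sum_option, Fintype.sum_sum_type] at h1
    simp only [Equiv.symm_apply_apply, F, Option.elim, Sum.elim_inl, Sum.elim_inr,
      ← dotp_eq_pairFn, dotp_sub_left] at h1
    have h0 : dotp 0 x = 0 := by simp [dotp]
    simp only [h0] at h1
    simp only [μ, ν]
    linarith
  let ν' : Fin m → ℝ := fun i => ν i - if i = b then ∑ j, ν j else 0
  have hν' : ∀ w : Fin m → ℝ, ∑ i, ν' i * w i = ∑ i, ν i * (w i - w b) := by
    intro w
    simp [ν', sub_mul, mul_sub, Finset.sum_mul]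
  have hmem : (ν', ∑ i, μ i * bb i) ∈ epi {x | ∀ i, dotp (a i) x ≤ bb i} A b := by
    refine ⟨⟨fun i hi => ?_, ?_⟩, fun x hx => ?_⟩
    · simpa [ν', hi] using ht _
    · simpa using hν' fun _ => 1
    · rw [pairFn_apply, hν']
      have h1 := hev x 0
      simp only [mul_zero, add_zero, neg_zero, zero_add] at h1
      have h2 : 0 ≤ ∑ i, μ i * (bb i - dotp (a i) x) :=
        Finset.sum_nonneg fun i _ => mul_nonneg (ht _) (sub_nonneg.2 (hx i))
      simp only [mul_sub, Finset.sum_sub_distrib] at h1 h2 ⊢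
      linarith
  have h1 := h _ hmem
  rw [pairFn_apply, hν'] at h1
  have h2 := hev 0 1
  have h0 : ∀ y : Fin n → ℝ, dotp y 0 = 0 := fun y => by simp [dotp]
  simp only [h0, sub_zero, zero_add, mul_one, mul_neg, Finset.sum_neg_distrib] at h2
  have h3 : 0 ≤ t (e none) := ht _
  simp only at h1
  linarith

end Epigraph

section CircuitGraph

variable {n m : ℕ} {X : Set (Fin n → ℝ)} {A : Fin m → Fin n → ℝ}

theorem ExpLinIndep.eq_zero (hLI : ExpLinIndep X A) {c : Fin m → ℝ}
    (hc : ∀ x ∈ X, ∑ i, c i * Real.exp (dotp (A i) x) = 0) : c = 0 := by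
  funext i
  refine Fintype.linearIndependent_iff.1 hLI c ?_ i
  funext x
  simpa using hc x x.2

theorem ExpLinIndep.exists_separating (hLI : ExpLinIndep X A) {i k : Fin m} (hik : i ≠ k) :
    ∃ x ∈ X, ∃ y ∈ X, dotp (A i) x - dotp (A i) y ≠ dotp (A k) x - dotp (A k) y := by
  by_contra! h
  rcases X.eq_empty_or_nonempty with rfl | ⟨y, hy⟩
  · have := congrFun (hLI.eq_zero (c := fun _ => 1) (by simp)) i
    simp at this
  · have := congrFun (hLI.eq_zero
      (c := Pi.single i 1 - Pi.single k (Real.exp (dotp (A i) y - dotp (A k) y))) (by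
        intro x hx
        simp only [Pi.sub_apply, sub_mul, Finset.sum_sub_distrib, Pi.single_apply, ite_mul,
          one_mul, zero_mul, Finset.sum_ite_eq', Finset.mem_univ, if_true]
        rw [← Real.exp_add, sub_eq_zero]
        congr 1
        linarith [h x hx y hy])) i
    simp [hik] at this

/-- There are weights that are strictly positive on every nonzero `ν ∈ N_β` for which
`x ↦ (𝒜ν)ᵀ x` is constant on `X`. -/
theorem ExpLinIndep.exists_weight (hLI : ExpLinIndep X A) :
    ∃ w : Fin m → ℝ, ∀ (b : Fin m), ∀ ν ∈ Nbeta b,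
      (∀ x ∈ X, ∀ y ∈ X, ∑ i, ν i * dotp (A i) x = ∑ i, ν i * dotp (A i) y) →
      0 < ∑ i, ν i * w i ∨ ν = 0 := by
  classical
  have hsep : ∀ q : Fin m × Fin m, ∃ g : Fin m → ℝ, (q.1 ≠ q.2 → g q.1 ≠ g q.2) ∧
      ∀ ν : Fin m → ℝ,
        (∀ x ∈ X, ∀ y ∈ X, ∑ i, ν i * dotp (A i) x = ∑ i, ν i * dotp (A i) y) →
        ∑ i, ν i * g i = 0 := by
    rintro ⟨i, k⟩
    by_cases hik : i = k
    · exact ⟨0, fun h => absurd hik h, by simp⟩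
    · obtain ⟨x, hx, y, hy, hne⟩ := hLI.exists_separating hik
      exact ⟨fun i => dotp (A i) x - dotp (A i) y, fun _ => hne, fun ν hν => by
        simp [mul_sub, hν x hx y hy]⟩
  choose g hg hg0 using hsep
  refine ⟨fun i => ∑ q, g q i ^ 2, fun b ν hν hconst => ?_⟩
  have hexp : ∀ q, ∑ i, ν i * g q i ^ 2 = ∑ i, ν i * (g q i - g q b) ^ 2 := by
    intro q
    have h1 := hg0 q ν hconst
    have h2 := hν.2
    have : ∀ i, ν i * (g q i - g q b) ^ 2 =
        ν i * g q i ^ 2 - 2 * g q b * (ν i * g q i) + g q b ^ 2 * ν i := fun i => by ring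
    simp only [this, Finset.sum_add_distrib, Finset.sum_sub_distrib, ← Finset.mul_sum, h1, h2]
    ring
  have hterm : ∀ q i, 0 ≤ ν i * (g q i - g q b) ^ 2 := by
    intro q i
    by_cases hi : i = b
    · simp [hi]
    · exact mul_nonneg (hν.1 i hi) (sq_nonneg _)
  have hsum : ∑ i, ν i * ∑ q, g q i ^ 2 = ∑ q, ∑ i, ν i * (g q i - g q b) ^ 2 := by
    simp only [Finset.mul_sum]
    rw [Finset.sum_comm]
    exact Finset.sum_congr rfl fun q _ => hexp q
  rw [hsum]
  by_cases hex : ∃ i, i ≠ b ∧ ν i ≠ 0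
  · left
    obtain ⟨i, hib, hνi⟩ := hex
    refine Finset.sum_pos' (fun q _ => Finset.sum_nonneg fun i _ => hterm q i)
      ⟨(i, b), Finset.mem_univ _, Finset.sum_pos' (fun j _ => hterm _ j)
        ⟨i, Finset.mem_univ _, mul_pos (lt_of_le_of_ne (hν.1 i hib) hνi.symm) ?_⟩⟩
    exact sq_pos_of_ne_zero (sub_ne_zero.2 (hg (i, b) hib))
  · right
    push Not at hex
    funext i
    by_cases hi : i = b
    · subst hi
      have := hν.2
      rwa [Finset.sum_eq_single i (fun j _ hj => hex j hj) (by simp)] at this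
    · exact hex i hi

/-- The cone generated by the epigraphs over all `N_β`. -/
noncomputable def epiHull (X : Set (Fin n → ℝ)) (A : Fin m → Fin n → ℝ) :
    PointedCone ℝ ((Fin m → ℝ) × ℝ) :=
  PointedCone.hull ℝ (⋃ b, (epi X A b : Set ((Fin m → ℝ) × ℝ)))

theorem epi_le_epiHull (b : Fin m) : epi X A b ≤ epiHull X A := fun _ hp =>
  PointedCone.subset_hull (Set.mem_iUnion.2 ⟨b, hp⟩)

theorem epiHull_salient (hX : X.Nonempty) (hLI : ExpLinIndep X A) :
    ∀ u ∈ epiHull X A, ∀ v ∈ epiHull X A, u + v = 0 → u = 0 := by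
  obtain ⟨w, hw⟩ := hLI.exists_weight
  have key : ∀ u ∈ epiHull X A, (∀ x ∈ X, 0 ≤ pairFn (fun i => dotp (A i) x) 1 u) ∧
      ((∀ x ∈ X, pairFn (fun i => dotp (A i) x) 1 u = 0) → 0 < pairFn w 0 u ∨ u = 0) := by
    intro u hu
    refine hull_induction (p := fun u => (∀ x ∈ X, 0 ≤ pairFn (fun i => dotp (A i) x) 1 u) ∧
      ((∀ x ∈ X, pairFn (fun i => dotp (A i) x) 1 u = 0) → 0 < pairFn w 0 u ∨ u = 0))
      ?_ (by simp) ?_ ?_ hu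
    · rintro p hp
      obtain ⟨b, hp1, hp2⟩ := Set.mem_iUnion.1 hp
      refine ⟨hp2, fun h0 => ?_⟩
      simp only [pairFn_apply, mul_one, mul_zero, add_zero] at h0 ⊢
      rcases hw b p.1 hp1 (fun x hx y hy => by linarith [h0 x hx, h0 y hy]) with h | h
      · exact Or.inl h
      · right
        obtain ⟨x, hx⟩ := hX
        have := h0 x hx
        simp only [h, Pi.zero_apply, zero_mul, Finset.sum_const_zero, zero_add] at this
        exact Prod.ext h this
    · rintro p q ⟨hp, hp'⟩ ⟨hq, hq'⟩
      refine ⟨fun x hx => by rw [map_add]; exact add_nonneg (hp x hx) (hq x hx), fun h0 => ?_⟩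
      simp only [map_add] at h0 ⊢
      rcases hp' (fun x hx => by linarith [hp x hx, hq x hx, h0 x hx]) with h1 | rfl
      · rcases hq' (fun x hx => by linarith [hp x hx, hq x hx, h0 x hx]) with h2 | rfl
        · left; linarith
        · left; simpa using h1
      · simpa using hq' (fun x hx => by linarith [hp x hx, hq x hx, h0 x hx])
    · rintro c p hc ⟨hp, hp'⟩
      refine ⟨fun x hx => by rw [map_smul]; exact mul_nonneg hc (hp x hx), fun h0 => ?_⟩
      rcases hc.eq_or_lt with rfl | hc
      · simp
      · rcases hp' (fun x hx => by
          have := h0 x hx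
          rw [map_smul, smul_eq_mul] at this
          exact (mul_eq_zero.1 this).resolve_left hc.ne') with h1 | rfl
        · left
          rw [map_smul]
          exact mul_pos hc h1
        · simp
  intro u hu v hv huv
  have hL : ∀ x ∈ X, pairFn (fun i => dotp (A i) x) 1 u = 0 ∧
      pairFn (fun i => dotp (A i) x) 1 v = 0 := by
    intro x hx
    have h0 : pairFn (fun i => dotp (A i) x) 1 (u + v) = 0 := by rw [huv, map_zero]
    rw [map_add] at h0
    have h1 := (key u hu).1 x hx
    have h2 := (key v hv).1 x hx
    constructor <;> linarith
  rcases (key u hu).2 (fun x hx => (hL x hx).1) with h1 | h1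
  · have h0 : pairFn w 0 (u + v) = 0 := by rw [huv, map_zero]
    rw [map_add] at h0
    rcases (key v hv).2 (fun x hx => (hL x hx).2) with h2 | rfl
    · linarith
    · simpa using huv
  · exact h1

theorem IsEdgeGenerator.smul {E : Type*} [AddCommGroup E] [Module ℝ E] {K : PointedCone ℝ E}
    {v : E} (hv : IsEdgeGenerator (K : Set E) v) {r : ℝ} (hr : 0 < r) :
    IsEdgeGenerator (K : Set E) (r • v) := by
  obtain ⟨hv0, hvK, hedge⟩ := hv
  refine ⟨smul_ne_zero hr.ne' hv0, K.smul_mem hr.le hvK, fun u hu w hw huw => ?_⟩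
  have hr' := (inv_pos.2 hr).le
  obtain ⟨⟨a, ha, hua⟩, ⟨c, hc, hwc⟩⟩ := hedge (r⁻¹ • u) (K.smul_mem hr' hu) (r⁻¹ • w)
    (K.smul_mem hr' hw) (by rw [← smul_add, ← huw, smul_smul, inv_mul_cancel₀ hr.ne', one_smul])
  refine ⟨⟨a, ha, ?_⟩, ⟨c, hc, ?_⟩⟩
  · rw [smul_comm, ← hua, smul_smul, mul_inv_cancel₀ hr.ne', one_smul]
  · rw [smul_comm, ← hwc, smul_smul, mul_inv_cancel₀ hr.ne', one_smul]

theorem neg_of_mem_Nbeta {b : Fin m} {ν : Fin m → ℝ} (hν : ν ∈ Nbeta b) (h0 : ν ≠ 0) :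
    ν b < 0 := by
  by_contra! hb
  have hnn : ∀ i ∈ Finset.univ, 0 ≤ ν i := fun i _ => by
    by_cases hi : i = b
    · exact hi ▸ hb
    · exact hν.1 i hi
  exact h0 (funext fun i => (Finset.sum_eq_zero_iff_of_nonneg hnn).1 hν.2 i (Finset.mem_univ i))

/-- An edge generator of the epigraph hull that lies over a nonzero `ν ∈ N_β` is the functional
form of an `X`-circuit. -/
theorem IsEdgeGenerator.isXCircuit (hX : X.Nonempty) {b : Fin m} {p : (Fin m → ℝ) × ℝ}
    (hp : IsEdgeGenerator (epiHull X A : Set ((Fin m → ℝ) × ℝ)) p) (hpb : p ∈ epi X A b)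
    (h0 : p.1 ≠ 0) : IsXCircuit X A b p.1 ∧ p = phiVec X A p.1 := by
  obtain ⟨ν, s⟩ := p
  obtain ⟨-, -, hedge⟩ := hp
  obtain ⟨hN, hs⟩ := mem_epi_iff_sigA_le.1 hpb
  simp only at hN hs h0
  have htop : sigA X A ν < ⊤ := hs.trans_lt (EReal.coe_lt_top s)
  have hσ := coe_toReal_sigA hX htop
  have hseq : s = (sigA X A ν).toReal := by
    have hle : (sigA X A ν).toReal ≤ s := by
      rw [← EReal.coe_le_coe_iff, hσ]
      exact hs
    have hvert : ((0 : Fin m → ℝ), s - (sigA X A ν).toReal) ∈ epi X A b :=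
      ⟨⟨by simp, by simp⟩, fun x _ => by simpa [pairFn_apply] using hle⟩
    obtain ⟨-, ⟨c, -, hc⟩⟩ := hedge _ (epi_le_epiHull b (phiVec_mem_epi hX hN htop)) _
      (epi_le_epiHull b hvert) (by simp [phiVec])
    obtain ⟨h1, h2⟩ := Prod.ext_iff.1 hc
    have hc0 : c = 0 := (smul_eq_zero.1 h1.symm).resolve_right h0
    simp only [hc0, zero_smul, Prod.snd_zero] at h2
    linarith
  refine ⟨⟨hN, h0, htop, ?_⟩, by simp [phiVec, hseq]⟩
  rintro ⟨ν₁, ν₂, θ, hν₁, hν₂, hprop, ⟨hθ0, hθ1⟩, hν, haff⟩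
  have haffθ := haff θ ⟨hθ0.le, hθ1.le⟩
  rw [← hν] at haffθ
  have hb₁ := sigA_ne_bot (A := A) hX ν₁
  have hb₂ := sigA_ne_bot (A := A) hX ν₂
  have ht₁ : sigA X A ν₁ < ⊤ := by
    rw [lt_top_iff_ne_top]
    intro h
    rw [h, EReal.coe_mul_top_of_pos hθ0, EReal.top_add_of_ne_bot] at haffθ
    · exact htop.ne haffθ
    · intro hbot
      induction hσ₂ : sigA X A ν₂ with
      | bot => exact hb₂ hσ₂
      | top =>
        rw [hσ₂, EReal.coe_mul_top_of_pos (sub_pos.2 hθ1)] at hbot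
        exact top_ne_bot hbot
      | coe r =>
        rw [hσ₂, ← EReal.coe_mul] at hbot
        exact EReal.coe_ne_bot _ hbot
  have ht₂ : sigA X A ν₂ < ⊤ := by
    rw [lt_top_iff_ne_top]
    intro h
    rw [h, EReal.coe_mul_top_of_pos (sub_pos.2 hθ1), ← coe_toReal_sigA hX ht₁,
      ← EReal.coe_mul, EReal.coe_add_top] at haffθ
    exact htop.ne haffθ
  rw [← coe_toReal_sigA hX ht₁, ← coe_toReal_sigA hX ht₂, ← hσ, ← EReal.coe_mul,
    ← EReal.coe_mul, ← EReal.coe_add, EReal.coe_eq_coe_iff, ← hseq] at haffθ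
  obtain ⟨⟨a, -, ha⟩, ⟨c, -, hc⟩⟩ := hedge (θ • phiVec X A ν₁)
    (PointedCone.smul_mem _ hθ0.le (epi_le_epiHull b (phiVec_mem_epi hX hν₁ ht₁)))
    ((1 - θ) • phiVec X A ν₂)
    (PointedCone.smul_mem _ (sub_nonneg.2 hθ1.le) (epi_le_epiHull b (phiVec_mem_epi hX hν₂ ht₂)))
    (Prod.ext hν haffθ)
  have ha' : θ • ν₁ = a • ν := congrArg Prod.fst ha
  have hc' : (1 - θ) • ν₂ = c • ν := congrArg Prod.fst hc
  have h1 : ν₁ = (θ⁻¹ * a) • ν := by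
    rw [mul_smul, ← ha', smul_smul, inv_mul_cancel₀ hθ0.ne', one_smul]
  have h2 : ν₂ = ((1 - θ)⁻¹ * c) • ν := by
    rw [mul_smul, ← hc', smul_smul, inv_mul_cancel₀ (sub_pos.2 hθ1).ne', one_smul]
  apply hprop
  by_cases hc0 : (1 - θ)⁻¹ * c = 0
  · exact ⟨0, Or.inr (by rw [h2, hc0, zero_smul, zero_smul])⟩
  · exact ⟨(θ⁻¹ * a) * ((1 - θ)⁻¹ * c)⁻¹, Or.inl (by
      rw [h1, h2, smul_smul, mul_assoc, inv_mul_cancel₀ hc0, mul_one])⟩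

theorem zero_one_mem_epi (b : Fin m) : ((0 : Fin m → ℝ), (1 : ℝ)) ∈ epi X A b :=
  ⟨⟨by simp, by simp⟩, fun x _ => by simp [pairFn_apply]⟩

theorem exists_epiHull_generators (hX : X.Nonempty) (hpoly : IsPolyhedron X)
    (hLI : ExpLinIndep X A) :
    ∃ T : Finset ((Fin m → ℝ) × ℝ),
      PointedCone.hull ℝ (T : Set ((Fin m → ℝ) × ℝ)) = epiHull X A ∧
      ∀ p ∈ T, IsEdgeGenerator (epiHull X A : Set ((Fin m → ℝ) × ℝ)) p ∧
        ∃ b, p ∈ epi X A b := by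
  classical
  choose S hS using epi_fg (A := A) hX hpoly
  have hSU : PointedCone.hull ℝ ((Finset.univ.biUnion S : Finset _) : Set ((Fin m → ℝ) × ℝ)) =
      epiHull X A := by
    simp only [Finset.coe_biUnion, Finset.coe_univ, Set.mem_univ, Set.iUnion_true, epiHull, ← hS,
      PointedCone.hull, Submodule.span_iUnion, Submodule.span_eq]
  obtain ⟨T, hTS, hTeq, hedge⟩ := exists_edge_generators (Finset.univ.biUnion S)
    (by rw [hSU]; exact epiHull_salient hX hLI)
  rw [hSU] at hTeq hedge
  refine ⟨T, hTeq, fun p hp => ⟨hedge p hp, ?_⟩⟩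
  obtain ⟨b, -, hb⟩ := Finset.mem_biUnion.1 (hTS hp)
  exact ⟨b, hS b ▸ PointedCone.subset_hull hb⟩

/-- The epigraph hull is generated by its edge generators that are functional forms of normalized
circuits, together with the vertical direction. -/
theorem epiHull_le_hull (hX : X.Nonempty) (hpoly : IsPolyhedron X) (hLI : ExpLinIndep X A) :
    epiHull X A ≤ PointedCone.hull ℝ ((phiVec X A '' {l | l ∈ Lambda X A ∧
      IsEdgeGenerator (epiHull X A : Set ((Fin m → ℝ) × ℝ)) (phiVec X A l)}) ∪
        {((0 : Fin m → ℝ), (1 : ℝ))}) := by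
  obtain ⟨T, hT, hTe⟩ := exists_epiHull_generators hX hpoly hLI
  rw [← hT]
  refine Submodule.span_le.2 fun p hp => ?_
  obtain ⟨hedge, b, hpb⟩ := hTe p hp
  rw [hT]
  by_cases h0 : p.1 = 0
  · obtain ⟨x, hx⟩ := hX
    have hp2 : 0 ≤ p.2 := by simpa [pairFn_apply, h0] using hpb.2 x hx
    have : p = p.2 • ((0 : Fin m → ℝ), (1 : ℝ)) := Prod.ext (by simpa using h0) (by simp)
    rw [this]
    exact PointedCone.smul_mem _ hp2 (PointedCone.subset_hull (Or.inr rfl))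
  · have hneg := neg_of_mem_Nbeta hpb.1 h0
    set r := -p.1 b with hr
    have hrpos : 0 < r := by linarith
    have hq : IsEdgeGenerator (epiHull X A : Set ((Fin m → ℝ) × ℝ)) (r⁻¹ • p) :=
      hedge.smul (inv_pos.2 hrpos)
    obtain ⟨hcirc, hphi⟩ := hq.isXCircuit hX (PointedCone.smul_mem _ (inv_pos.2 hrpos).le hpb)
      (smul_ne_zero (inv_pos.2 hrpos).ne' h0)
    have hp' : p = r • (r⁻¹ • p) := by rw [smul_smul, mul_inv_cancel₀ hrpos.ne', one_smul]
    rw [hp']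
    refine PointedCone.smul_mem _ hrpos.le (PointedCone.subset_hull (Or.inl ?_))
    refine ⟨(r⁻¹ • p).1, ⟨Set.mem_iUnion.2 ⟨b, hcirc, ?_⟩, hphi ▸ hq⟩, hphi.symm⟩
    have : p.1 b = -r := by rw [hr, neg_neg]
    simp [this, hrpos.ne']

theorem circuitGraph_eq_epiHull (hX : X.Nonempty) (hpoly : IsPolyhedron X) (hm : 0 < m)
    (hLI : ExpLinIndep X A) :
    circuitGraph X A = (epiHull X A : Set ((Fin m → ℝ) × ℝ)) := by
  rw [circuitGraph, coneHull_eq_hull]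
  congr 1
  refine le_antisymm (Submodule.span_le.2 ?_) ((epiHull_le_hull hX hpoly hLI).trans
    (Submodule.span_mono (Set.union_subset_union_left _ (Set.image_mono fun l hl => hl.1))))
  rintro p (⟨l, hl, rfl⟩ | rfl)
  · obtain ⟨b, hcirc, -⟩ := Set.mem_iUnion.1 hl
    exact epi_le_epiHull b (phiVec_mem_epi hX hcirc.1 hcirc.2.2.1)
  · exact epi_le_epiHull ⟨0, hm⟩ (zero_one_mem_epi _)

theorem epiHull_le_hull_LambdaStar (hX : X.Nonempty) (hpoly : IsPolyhedron X) (hm : 0 < m)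
    (hLI : ExpLinIndep X A) :
    epiHull X A ≤ PointedCone.hull ℝ ((phiVec X A '' LambdaStar X A) ∪
        {((0 : Fin m → ℝ), (1 : ℝ))}) := by
  rw [LambdaStar, circuitGraph_eq_epiHull hX hpoly hm hLI]
  exact epiHull_le_hull hX hpoly hLI

theorem eq_of_mem_Lambda_of_smul {l l' : Fin m → ℝ} (hl : l ∈ Lambda X A)
    (hl' : l' ∈ Lambda X A) {r : ℝ} (hr : 0 < r) (h : l = r • l') : l = l' := by
  obtain ⟨b, hc, hb⟩ := Set.mem_iUnion.1 hl
  obtain ⟨b', hc', hb'⟩ := Set.mem_iUnion.1 hl'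
  have h1 : l b = r * l' b := congrFun h b
  have hbb : b = b' := by
    by_contra hne
    have := mul_nonneg hr.le (hc'.1.1 b hne)
    linarith
  subst hbb
  have : r = 1 := by rw [hb, hb'] at h1; linarith
  rw [h, this, one_smul]

theorem LambdaStar_finite (hX : X.Nonempty) (hpoly : IsPolyhedron X) (hm : 0 < m)
    (hLI : ExpLinIndep X A) : (LambdaStar X A).Finite := by
  obtain ⟨T, hT, -⟩ := exists_epiHull_generators hX hpoly hLI
  have hex : ∀ l ∈ LambdaStar X A, ∃ s ∈ T, ∃ r : ℝ, 0 < r ∧ phiVec X A l = r • s := by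
    intro l hl
    have := hl.2
    rw [circuitGraph_eq_epiHull hX hpoly hm hLI, ← hT] at this
    exact this.exists_smul_mem
  choose! s hsT r hr hs using hex
  refine Set.Finite.of_finite_image (f := s)
    (T.finite_toSet.subset (Set.image_subset_iff.2 fun l hl => hsT l hl)) ?_
  intro l hl l' hl' heq
  refine eq_of_mem_Lambda_of_smul hl.1 hl'.1 (mul_pos (hr l hl) (inv_pos.2 (hr l' hl'))) ?_
  have h1 : l = r l • (s l).1 := congrArg Prod.fst (hs l hl)
  have h2 : l' = r l' • (s l').1 := congrArg Prod.fst (hs l' hl')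
  rw [mul_smul]
  nth_rw 2 [h2]
  rw [smul_smul (r l')⁻¹, inv_mul_cancel₀ (hr l' hl').ne', one_smul, ← heq]
  exact h1

theorem LambdaStar_nonempty (hX : X.Nonempty) (hpoly : IsPolyhedron X) (hm : 0 < m)
    (hLI : ExpLinIndep X A) (hL : (Lambda X A).Nonempty) : (LambdaStar X A).Nonempty := by
  by_contra! hempty
  obtain ⟨l, hl⟩ := hL
  obtain ⟨b, hcirc, -⟩ := Set.mem_iUnion.1 hl
  have hmem := epiHull_le_hull_LambdaStar hX hpoly hm hLI
    (epi_le_epiHull b (phiVec_mem_epi hX hcirc.1 hcirc.2.2.1))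
  rw [hempty, Set.image_empty, Set.empty_union] at hmem
  refine hcirc.2.1 (hull_induction (p := fun p : (Fin m → ℝ) × ℝ => p.1 = 0) ?_ rfl ?_ ?_ hmem)
  · rintro p rfl
    rfl
  · intro p q hp hq
    simp [hp, hq]
  · intro c p _ hp
    simp [hp]

end CircuitGraph

section ClosedImage

/-- The image of a closed cone under a linear map whose kernel meets the cone only in `0` is
closed. -/
theorem isClosed_cone_map {V W : Type*} [NormedAddCommGroup V] [NormedSpace ℝ V]
    [FiniteDimensional ℝ V] [NormedAddCommGroup W] [NormedSpace ℝ W] (L : V →ₗ[ℝ] W)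
    (C : PointedCone ℝ V) (hC : IsClosed (C : Set V)) (h0 : ∀ c ∈ C, L c = 0 → c = 0) :
    IsClosed (PointedCone.map L C : Set W) := by
  have hLc : Continuous L := L.continuous_of_finiteDimensional
  obtain ⟨δ, hδ, hbound⟩ : ∃ δ : ℝ, 0 < δ ∧ ∀ c ∈ C, δ * ‖c‖ ≤ ‖L c‖ := by
    have hcpt : IsCompact (Metric.sphere (0 : V) 1 ∩ C) := (isCompact_sphere 0 1).inter_right hC
    have key : ∃ δ : ℝ, 0 < δ ∧ ∀ c ∈ Metric.sphere (0 : V) 1 ∩ C, δ ≤ ‖L c‖ := by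
      rcases (Metric.sphere (0 : V) 1 ∩ C).eq_empty_or_nonempty with he | hne
      · exact ⟨1, one_pos, fun c hc => absurd hc (by simp [he])⟩
      · obtain ⟨c₀, hc₀, hmin⟩ := hcpt.exists_isMinOn hne hLc.norm.continuousOn
        refine ⟨‖L c₀‖, norm_pos_iff.2 fun h => ?_, fun c hc => hmin hc⟩
        have h1 : ‖c₀‖ = 1 := by simpa using hc₀.1
        rw [h0 c₀ hc₀.2 h, norm_zero] at h1
        exact zero_ne_one h1
    obtain ⟨δ, hδ, hmin⟩ := key
    refine ⟨δ, hδ, fun c hc => ?_⟩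
    rcases eq_or_ne c 0 with rfl | hne
    · simp
    have hpos : 0 < ‖c‖ := norm_pos_iff.2 hne
    have h1 := hmin (‖c‖⁻¹ • c) ⟨by simp [norm_smul, hpos.ne'],
      C.smul_mem (inv_nonneg.2 hpos.le) hc⟩
    rw [map_smul, norm_smul, norm_inv, norm_norm, le_inv_mul_iff₀ hpos] at h1
    linarith
  refine isClosed_of_closure_subset fun y hy => ?_
  set T : Set W := L '' ((C : Set V) ∩ Metric.closedBall 0 ((‖y‖ + 1) / δ)) with hT
  have hTc : IsClosed T :=
    (((isCompact_closedBall (0 : V) ((‖y‖ + 1) / δ)).inter_left hC).image hLc).isClosed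
  have hyT : y ∈ closure T := by
    rw [Metric.mem_closure_iff] at hy ⊢
    intro ε hε
    obtain ⟨w, hw, hd⟩ := hy (min ε 1) (lt_min hε one_pos)
    obtain ⟨c, hc, rfl⟩ := hw
    refine ⟨L c, ⟨c, ⟨hc, ?_⟩, rfl⟩, hd.trans_le (min_le_left _ _)⟩
    have h1 : dist y (L c) < 1 := hd.trans_le (min_le_right _ _)
    rw [dist_eq_norm, norm_sub_rev] at h1
    have h2 : ‖L c‖ ≤ ‖L c - y‖ + ‖y‖ := by simpa using norm_add_le (L c - y) y
    rw [mem_closedBall_zero_iff, le_div_iff₀ hδ, mul_comm]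
    linarith [hbound c hc]
  rw [hTc.closure_eq] at hyT
  obtain ⟨c, ⟨hc, -⟩, rfl⟩ := hyT
  exact ⟨c, hc, rfl⟩

end ClosedImage

section Witness

/-- Superadditivity of the weighted geometric mean. -/
theorem prod_rpow_add_le {ι : Type*} (s : Finset ι) (w a b : ι → ℝ) (hw : ∀ i ∈ s, 0 < w i)
    (hsum : ∑ i ∈ s, w i = 1) (ha : ∀ i ∈ s, 0 ≤ a i) (hb : ∀ i ∈ s, 0 ≤ b i) :
    ∏ i ∈ s, a i ^ w i + ∏ i ∈ s, b i ^ w i ≤ ∏ i ∈ s, (a i + b i) ^ w i := by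
  by_cases h : ∃ j ∈ s, a j + b j = 0
  · obtain ⟨j, hj, h⟩ := h
    have haj : a j = 0 := by linarith [ha j hj, hb j hj]
    have hbj : b j = 0 := by linarith [ha j hj, hb j hj]
    rw [Finset.prod_eq_zero hj (by rw [haj, Real.zero_rpow (hw j hj).ne']),
      Finset.prod_eq_zero hj (by rw [hbj, Real.zero_rpow (hw j hj).ne']), add_zero]
    exact Finset.prod_nonneg fun i hi => Real.rpow_nonneg (add_nonneg (ha i hi) (hb i hi)) _
  · push Not at h
    have hpos : ∀ i ∈ s, 0 < a i + b i := fun i hi =>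
      (add_nonneg (ha i hi) (hb i hi)).lt_of_ne' (h i hi)
    have key : ∀ c : ι → ℝ, (∀ i ∈ s, 0 ≤ c i) → ∏ i ∈ s, c i ^ w i ≤
        (∑ i ∈ s, w i * (c i / (a i + b i))) * ∏ i ∈ s, (a i + b i) ^ w i := by
      intro c hc
      have h1 := Real.geom_mean_le_arith_mean_weighted s w (fun i => c i / (a i + b i))
        (fun i hi => (hw i hi).le) hsum fun i hi => div_nonneg (hc i hi) (hpos i hi).le
      have h2 : ∏ i ∈ s, c i ^ w i =
          (∏ i ∈ s, (c i / (a i + b i)) ^ w i) * ∏ i ∈ s, (a i + b i) ^ w i := by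
        rw [← Finset.prod_mul_distrib]
        refine Finset.prod_congr rfl fun i hi => ?_
        rw [← Real.mul_rpow (div_nonneg (hc i hi) (hpos i hi).le) (hpos i hi).le,
          div_mul_cancel₀ _ (hpos i hi).ne']
      rw [h2]
      exact mul_le_mul_of_nonneg_right h1
        (Finset.prod_nonneg fun i hi => Real.rpow_nonneg (hpos i hi).le _)
    refine (add_le_add (key a ha) (key b hb)).trans_eq ?_
    rw [← add_mul, ← Finset.sum_add_distrib]
    have : ∑ i ∈ s, (w i * (a i / (a i + b i)) + w i * (b i / (a i + b i))) = 1 := by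
      rw [← hsum]
      refine Finset.sum_congr rfl fun i hi => ?_
      rw [← mul_add, ← add_div, div_self (hpos i hi).ne', mul_one]
    rw [this, one_mul]

variable {n m : ℕ} {X : Set (Fin n → ℝ)} {A : Fin m → Fin n → ℝ} {b : Fin m} {l : Fin m → ℝ}

theorem sum_mul_of_normalized (hl : l ∈ Nbeta b) (hb : l b = -1) (z : Fin m → ℝ) :
    ∑ i, l i * z i = ∑ i ∈ Finset.univ.filter (fun i => 0 < l i), l i * z i - z b := by
  rw [← Finset.add_sum_erase _ _ (Finset.mem_univ b), hb, neg_one_mul, neg_add_eq_sub]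
  congr 1
  symm
  refine Finset.sum_subset (fun i hi => ?_) fun i hi hi' => ?_
  · rw [Finset.mem_erase]
    refine ⟨fun h => ?_, Finset.mem_univ i⟩
    have := (Finset.mem_filter.1 hi).2
    rw [h, hb] at this
    linarith
  · have h1 := hl.1 i (Finset.ne_of_mem_erase hi)
    have h2 : ¬ 0 < l i := fun h => hi' (Finset.mem_filter.2 ⟨Finset.mem_univ i, h⟩)
    rw [le_antisymm (not_lt.1 h2) h1, zero_mul]

theorem sum_pos_of_normalized (hl : l ∈ Nbeta b) (hb : l b = -1) :
    ∑ i ∈ Finset.univ.filter (fun i => 0 < l i), l i = 1 := by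
  have h := sum_mul_of_normalized hl hb fun _ => 1
  simp only [mul_one] at h
  linarith [hl.2]

theorem ne_of_pos_of_normalized (hb : l b = -1) {i : Fin m} (hi : 0 < l i) : i ≠ b := by
  rintro rfl
  linarith

/-- The `λ`-witnessed AGE cone as a pointed cone. -/
noncomputable def witnessPointedCone (X : Set (Fin n → ℝ)) (A : Fin m → Fin n → ℝ)
    (hl : l ∈ Nbeta b) (hb : l b = -1) : PointedCone ℝ (Fin m → ℝ) where
  carrier := WitnessCone X A b l
  add_mem' := by
    rintro c d ⟨hc, hc'⟩ ⟨hd, hd'⟩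
    refine ⟨fun i hi => add_nonneg (hc i hi) (hd i hi), ?_⟩
    have h := prod_rpow_add_le (Finset.univ.filter fun i => 0 < l i) l (fun i => c i / l i)
      (fun i => d i / l i) (fun i hi => (Finset.mem_filter.1 hi).2) (sum_pos_of_normalized hl hb)
      (fun i hi => div_nonneg (hc i (ne_of_pos_of_normalized hb (Finset.mem_filter.1 hi).2))
        (Finset.mem_filter.1 hi).2.le)
      (fun i hi => div_nonneg (hd i (ne_of_pos_of_normalized hb (Finset.mem_filter.1 hi).2))
        (Finset.mem_filter.1 hi).2.le)
    simp only [Pi.add_apply, add_div]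
    linarith
  zero_mem' := by
    refine ⟨fun i _ => le_rfl, ?_⟩
    simp only [Pi.zero_apply, neg_zero, zero_mul, zero_div]
    exact Finset.prod_nonneg fun i _ => Real.rpow_nonneg le_rfl _
  smul_mem' := by
    rintro ⟨t, ht⟩ c ⟨hc, hc'⟩
    change t • c ∈ _
    refine ⟨fun i hi => mul_nonneg ht (hc i hi), ?_⟩
    have h : ∏ i ∈ Finset.univ.filter (fun i => 0 < l i), (t * c i / l i) ^ l i =
        t * ∏ i ∈ Finset.univ.filter (fun i => 0 < l i), (c i / l i) ^ l i := by
      have h1 : t = ∏ i ∈ Finset.univ.filter (fun i => 0 < l i), t ^ l i := by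
        rw [← Real.rpow_sum_of_nonneg ht fun i hi => (Finset.mem_filter.1 hi).2.le,
          sum_pos_of_normalized hl hb, Real.rpow_one]
      conv_rhs => rw [h1]
      rw [← Finset.prod_mul_distrib]
      refine Finset.prod_congr rfl fun i hi => ?_
      have hi := (Finset.mem_filter.1 hi).2
      rw [mul_div_assoc, Real.mul_rpow ht
        (div_nonneg (hc i (ne_of_pos_of_normalized hb hi)) hi.le)]
    simp only [Pi.smul_apply, smul_eq_mul, h]
    nlinarith [mul_le_mul_of_nonneg_left hc' ht]

theorem mem_witnessPointedCone (hl : l ∈ Nbeta b) (hb : l b = -1) {c : Fin m → ℝ} :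
    c ∈ witnessPointedCone X A hl hb ↔ c ∈ WitnessCone X A b l := Iff.rfl

theorem isClosed_WitnessCone (X : Set (Fin n → ℝ)) (A : Fin m → Fin n → ℝ) (b : Fin m)
    (l : Fin m → ℝ) : IsClosed (WitnessCone X A b l) := by
  have h1 : IsClosed {c : Fin m → ℝ | ∀ i, i ≠ b → 0 ≤ c i} := by
    have : {c : Fin m → ℝ | ∀ i, i ≠ b → 0 ≤ c i} = ⋂ i, ⋂ _ : i ≠ b, {c | 0 ≤ c i} := by
      ext c
      simp
    rw [this]
    exact isClosed_iInter fun i => isClosed_iInter fun _ =>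
      isClosed_le continuous_const (continuous_apply i)
  refine h1.inter (isClosed_le ((continuous_apply b).neg.mul continuous_const)
    (continuous_finsetProd _ fun i hi => ?_))
  exact ((continuous_apply i).div_const _).rpow_const fun _ =>
    Or.inr (Finset.mem_filter.1 hi).2.le

theorem mem_WitnessCone_of_nonneg {c : Fin m → ℝ} (hc : ∀ i, 0 ≤ c i) :
    c ∈ WitnessCone X A b l := by
  refine ⟨fun i _ => hc i, ?_⟩
  refine (mul_nonpos_of_nonpos_of_nonneg (neg_nonpos.2 (hc b)) (Real.exp_pos _).le).trans ?_
  exact Finset.prod_nonneg fun i hi =>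
    Real.rpow_nonneg (div_nonneg (hc i) (Finset.mem_filter.1 hi).2.le) _

theorem WitnessCone_subset_AgeCone (hX : X.Nonempty) (hl : l ∈ Nbeta b) (hb : l b = -1)
    (hσ : sigA X A l < ⊤) : WitnessCone X A b l ⊆ AgeCone X A b := by
  rintro c ⟨hc, hc'⟩
  refine ⟨hc, fun x hx => ?_⟩
  set P := Finset.univ.filter fun i => 0 < l i with hP
  have hPpos : ∀ i ∈ P, 0 < l i := fun i hi => (Finset.mem_filter.1 hi).2
  have hcP : ∀ i ∈ P, 0 ≤ c i := fun i hi => hc i (ne_of_pos_of_normalized hb (hPpos i hi))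
  have hbP : b ∉ P := fun h => ne_of_pos_of_normalized hb (hPpos b h) rfl
  set z : Fin m → ℝ := fun i => dotp (A i) x with hz
  have hφ : z b ≤ ∑ i ∈ P, l i * z i + (sigA X A l).toReal := by
    have h := (sigA_le_iff l _).1 (coe_toReal_sigA hX hσ).ge x hx
    have h2 := sum_mul_of_normalized hl hb z
    simp only [hz] at h2 ⊢
    linarith
  have hle : ∑ i ∈ P, c i * Real.exp (z i) + c b * Real.exp (z b) ≤
      ∑ i, c i * Real.exp (z i) := by
    rw [add_comm, ← Finset.sum_insert (f := fun i => c i * Real.exp (z i)) hbP]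
    refine Finset.sum_le_sum_of_subset_of_nonneg (Finset.subset_univ _) fun i _ hi => ?_
    exact mul_nonneg (hc i fun h => hi (h ▸ Finset.mem_insert_self _ _)) (Real.exp_pos _).le
  refine le_trans ?_ hle
  rcases le_or_gt 0 (c b) with hcb | hcb
  · exact add_nonneg (Finset.sum_nonneg fun i hi => mul_nonneg (hcP i hi) (Real.exp_pos _).le)
      (mul_nonneg hcb (Real.exp_pos _).le)
  have hamgm := Real.geom_mean_le_arith_mean_weighted P l
    (fun i => c i / l i * Real.exp (z i)) (fun i hi => (hPpos i hi).le)
    (sum_pos_of_normalized hl hb)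
    fun i hi => mul_nonneg (div_nonneg (hcP i hi) (hPpos i hi).le) (Real.exp_pos _).le
  have h1 : ∑ i ∈ P, l i * (c i / l i * Real.exp (z i)) = ∑ i ∈ P, c i * Real.exp (z i) :=
    Finset.sum_congr rfl fun i hi => by
      have := (hPpos i hi).ne'
      field_simp
  have h2 : ∏ i ∈ P, (c i / l i * Real.exp (z i)) ^ l i =
      (∏ i ∈ P, (c i / l i) ^ l i) * Real.exp (∑ i ∈ P, l i * z i) := by
    rw [Real.exp_sum, ← Finset.prod_mul_distrib]
    refine Finset.prod_congr rfl fun i hi => ?_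
    rw [Real.mul_rpow (div_nonneg (hcP i hi) (hPpos i hi).le) (Real.exp_pos _).le,
      ← Real.exp_mul, mul_comm (z i)]
  have h3 := mul_le_mul_of_nonneg_right hc' (Real.exp_pos (∑ i ∈ P, l i * z i)).le
  rw [mul_assoc, ← Real.exp_add, add_comm] at h3
  have h4 := mul_le_mul_of_nonneg_left (Real.exp_le_exp.2 hφ) (neg_pos.2 hcb).le
  linarith

theorem mem_WitnessCone_of_eq (hl : l ∈ Nbeta b) (hb : l b = -1) (z : Fin m → ℝ) :
    (fun i => if i = b then
        -Real.exp (-(∑ j ∈ Finset.univ.filter (fun j => 0 < l j), l j * z j +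
          (sigA X A l).toReal))
      else l i * Real.exp (-z i)) ∈ WitnessCone X A b l := by
  constructor
  · intro i hi
    simp only [if_neg hi]
    exact mul_nonneg (hl.1 i hi) (Real.exp_pos _).le
  · simp only [if_true, neg_neg]
    rw [← Real.exp_add, neg_add, neg_add_cancel_right, ← Finset.sum_neg_distrib, Real.exp_sum]
    refine Finset.prod_le_prod (fun i _ => (Real.exp_pos _).le) fun i hi => ?_
    have hi := (Finset.mem_filter.1 hi).2
    rw [if_neg (ne_of_pos_of_normalized hb hi), mul_div_cancel_left₀ _ hi.ne', ← Real.exp_mul]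
    exact (congrArg Real.exp (by ring)).le

end Witness

section SageCone

variable {n m : ℕ} {X : Set (Fin n → ℝ)} {A : Fin m → Fin n → ℝ}

theorem zero_mem_AgeCone (b : Fin m) : (0 : Fin m → ℝ) ∈ AgeCone X A b :=
  ⟨fun _ _ => le_rfl, fun _ _ => by simp⟩

theorem AgeCone_add {b : Fin m} {c d : Fin m → ℝ} (hc : c ∈ AgeCone X A b)
    (hd : d ∈ AgeCone X A b) : c + d ∈ AgeCone X A b := by
  refine ⟨fun i hi => add_nonneg (hc.1 i hi) (hd.1 i hi), fun x hx => ?_⟩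
  simp only [Pi.add_apply, add_mul, Finset.sum_add_distrib]
  exact add_nonneg (hc.2 x hx) (hd.2 x hx)

theorem zero_mem_Sage : (0 : Fin m → ℝ) ∈ Sage X A :=
  ⟨fun _ => 0, zero_mem_AgeCone, by simp⟩

theorem Sage_add {c d : Fin m → ℝ} (hc : c ∈ Sage X A) (hd : d ∈ Sage X A) :
    c + d ∈ Sage X A := by
  obtain ⟨f, hf, rfl⟩ := hc
  obtain ⟨g, hg, rfl⟩ := hd
  exact ⟨f + g, fun b => AgeCone_add (hf b) (hg b), by simp [Finset.sum_add_distrib]⟩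

theorem AgeCone_subset_Sage (b : Fin m) : AgeCone X A b ⊆ Sage X A := by
  intro c hc
  refine ⟨Pi.single b c, fun b' => ?_, by simp⟩
  rcases eq_or_ne b' b with rfl | h
  · simpa using hc
  · simpa [h] using zero_mem_AgeCone b'

/-- A positive functional nonnegative on the cones witnessed by reduced circuits is nonnegative
on the SAGE cone. -/
theorem dual_nonneg_on_Sage (hX : X.Nonempty) (hpoly : IsPolyhedron X) (hm : 0 < m)
    (hLI : ExpLinIndep X A) {v : Fin m → ℝ} (hv : ∀ i, 0 < v i)
    (h : ∀ l ∈ LambdaStar X A, ∀ b, l b = -1 → ∀ c ∈ WitnessCone X A b l, 0 ≤ ∑ i, v i * c i)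
    {c : Fin m → ℝ} (hc : c ∈ Sage X A) : 0 ≤ ∑ i, v i * c i := by
  have hexp : ∀ i, Real.exp (Real.log (v i)) = v i := fun i => Real.exp_log (hv i)
  have hphi : ∀ l ∈ LambdaStar X A, 0 ≤ pairFn (fun i => Real.log (v i)) 1 (phiVec X A l) := by
    intro l hl
    obtain ⟨b, hcirc, hb⟩ := Set.mem_iUnion.1 hl.1
    have hmem := h l hl b hb _ (mem_WitnessCone_of_eq hcirc.1 hb fun i => Real.log (v i))
    have hsplit := sum_mul_of_normalized hcirc.1 hb fun i => Real.log (v i)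
    simp only [pairFn_apply, phiVec, mul_one]
    set s := ∑ i ∈ Finset.univ.filter (fun i => 0 < l i), l i * Real.log (v i) +
      (sigA X A l).toReal with hs
    have hsum : ∑ i, v i * (if i = b then -Real.exp (-s) else l i * Real.exp (-Real.log (v i))) =
        1 - v b * Real.exp (-s) := by
      have h1 : ∀ i, v i * (if i = b then -Real.exp (-s)
          else l i * Real.exp (-Real.log (v i))) =
          l i + if i = b then 1 - v b * Real.exp (-s) else 0 := by
        intro i
        split_ifs with hi
        · subst hi
          rw [hb]
          ring
        · rw [Real.exp_neg, hexp, mul_left_comm, mul_inv_cancel₀ (hv i).ne']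
          ring
      rw [Finset.sum_congr rfl fun i _ => h1 i, Finset.sum_add_distrib, hcirc.1.2]
      simp
    rw [hsum, sub_nonneg] at hmem
    nth_rw 1 [← hexp b] at hmem
    rw [← Real.exp_add, Real.exp_le_one_iff] at hmem
    linarith
  have hhull : ∀ p ∈ epiHull X A, 0 ≤ pairFn (fun i => Real.log (v i)) 1 p := by
    intro p hp
    refine hull_induction (p := fun q => 0 ≤ pairFn (fun i => Real.log (v i)) 1 q) ?_ (by simp)
      ?_ ?_ (epiHull_le_hull_LambdaStar hX hpoly hm hLI hp)
    · rintro q (⟨l, hl, rfl⟩ | rfl)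
      · exact hphi l hl
      · simp [pairFn_apply]
    · intro p q hp hq
      rw [map_add]
      exact add_nonneg hp hq
    · intro c q hc hq
      rw [map_smul]
      exact mul_nonneg hc hq
  obtain ⟨f, hf, rfl⟩ := hc
  simp only [Finset.sum_apply, Finset.mul_sum]
  rw [Finset.sum_comm]
  refine Finset.sum_nonneg fun b _ => ?_
  obtain ⟨x, hx, hle⟩ := exists_point_of_nonneg_on_epi hpoly b (fun i => Real.log (v i))
    fun p hp => hhull p (epi_le_epiHull b hp)
  have hmul : 0 ≤ v b * Real.exp (-dotp (A b) x) * ∑ i, f b i * Real.exp (dotp (A i) x) :=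
    mul_nonneg (mul_pos (hv b) (Real.exp_pos _)).le ((hf b).2 x hx)
  refine hmul.trans ?_
  rw [Finset.mul_sum]
  refine Finset.sum_le_sum fun i _ => ?_
  have heq : v b * Real.exp (-dotp (A b) x) * (f b i * Real.exp (dotp (A i) x)) =
      f b i * Real.exp (dotp (A i) x - dotp (A b) x + Real.log (v b)) := by
    rw [Real.exp_add, hexp, sub_eq_add_neg, Real.exp_add]
    ring
  rw [heq]
  rcases eq_or_ne i b with rfl | hi
  · rw [sub_self, zero_add, hexp, mul_comm]
  · rw [mul_comm (v i)]
    refine mul_le_mul_of_nonneg_left ?_ ((hf b).1 i hi)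
    rw [← hexp i]
    exact Real.exp_le_exp.2 (by linarith [hle i])

/-- A closed pointed cone inside the SAGE cone containing all cones witnessed by reduced circuits
contains the SAGE cone. -/
theorem Sage_subset_of_isClosed (hX : X.Nonempty) (hpoly : IsPolyhedron X) (hm : 0 < m)
    (hLI : ExpLinIndep X A) (hL : (LambdaStar X A).Nonempty) (K : PointedCone ℝ (Fin m → ℝ))
    (hK : IsClosed (K : Set (Fin m → ℝ)))
    (hW : ∀ l ∈ LambdaStar X A, ∀ b, l b = -1 → WitnessCone X A b l ⊆ K) :
    Sage X A ⊆ K := by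
  intro c hc
  by_contra hcK
  obtain ⟨f, hf, hfc⟩ := ProperCone.hyperplane_separation_point
    (⟨K, hK⟩ : ProperCone ℝ (Fin m → ℝ)) hcK
  set v : Fin m → ℝ := fun i => f (Pi.single i 1) with hv
  have hfv : ∀ d : Fin m → ℝ, f d = ∑ i, v i * d i := by
    intro d
    conv_lhs => rw [pi_eq_sum_univ' d, map_sum]
    refine Finset.sum_congr rfl fun i _ => ?_
    rw [map_smul, smul_eq_mul, mul_comm]
  obtain ⟨l₀, hl₀⟩ := hL
  obtain ⟨b₀, hcirc₀, hb₀⟩ := Set.mem_iUnion.1 hl₀.1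
  have hv0 : ∀ i, 0 ≤ v i := fun i => hf _ (hW l₀ hl₀ b₀ hb₀ (mem_WitnessCone_of_nonneg
    fun j => by rw [Pi.single_apply]; split_ifs <;> norm_num))
  obtain ⟨x₀, hx₀⟩ := id hX
  have hpert : ∀ ε : ℝ, 0 < ε → 0 ≤ f c + ε * ∑ i, Real.exp (dotp (A i) x₀) * c i := by
    intro ε hε
    have hexpand : ∀ d : Fin m → ℝ, ∑ i, (v i + ε * Real.exp (dotp (A i) x₀)) * d i =
        f d + ε * ∑ i, Real.exp (dotp (A i) x₀) * d i := by
      intro d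
      rw [hfv, Finset.mul_sum, ← Finset.sum_add_distrib]
      exact Finset.sum_congr rfl fun i _ => by ring
    rw [← hexpand]
    refine dual_nonneg_on_Sage hX hpoly hm hLI
      (fun i => add_pos_of_nonneg_of_pos (hv0 i) (mul_pos hε (Real.exp_pos _))) ?_ hc
    intro l hl b hb d hd
    obtain ⟨b', hcirc, hb'⟩ := Set.mem_iUnion.1 hl.1
    have hbb : b = b' := by
      by_contra hne
      linarith [hcirc.1.1 b hne]
    subst hbb
    rw [hexpand]
    refine add_nonneg (hf d (hW l hl b hb hd)) (mul_nonneg hε.le ?_)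
    simpa only [mul_comm] using
      (WitnessCone_subset_AgeCone hX hcirc.1 hb hcirc.2.2.1 hd).2 x₀ hx₀
  have hlim : 0 ≤ f c := by
    refine ge_of_tendsto (x := nhdsWithin (0 : ℝ) (Set.Ioi 0))
      (f := fun ε : ℝ => f c + ε * ∑ i, Real.exp (dotp (A i) x₀) * c i) ?_ ?_
    · have : Filter.Tendsto (fun ε : ℝ => f c + ε * ∑ i, Real.exp (dotp (A i) x₀) * c i)
          (nhds 0) (nhds (f c + 0 * ∑ i, Real.exp (dotp (A i) x₀) * c i)) :=
        Continuous.tendsto (by fun_prop) 0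
      rw [zero_mul, add_zero] at this
      exact this.mono_left nhdsWithin_le_nhds
    · filter_upwards [self_mem_nhdsWithin] with ε hε
      exact hpert ε hε
  linarith

theorem Sage_eq_MinkSumOver (hX : X.Nonempty) (hpoly : IsPolyhedron X) (hm : 0 < m)
    (hLI : ExpLinIndep X A) (hL : (Lambda X A).Nonempty) :
    Sage X A = MinkSumOver (LambdaStar X A) (WitnessConeL X A) := by
  classical
  refine Set.Subset.antisymm ?_ ?_
  · have hfin := LambdaStar_finite (A := A) hX hpoly hm hLI
    have : Fintype (LambdaStar X A) := hfin.fintype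
    have hex : ∀ l : LambdaStar X A, ∃ b, IsXCircuit X A b l ∧ (l : Fin m → ℝ) b = -1 :=
      fun l => Set.mem_iUnion.1 l.2.1
    choose β hβ hβ1 using hex
    let D : PointedCone ℝ (LambdaStar X A → Fin m → ℝ) :=
      Submodule.pi Set.univ fun l => witnessPointedCone X A (hβ l).1 (hβ1 l)
    have hD : ∀ g, g ∈ D ↔ ∀ l, g l ∈ WitnessCone X A (β l) l := fun g => by
      simp [D, Submodule.mem_pi, mem_witnessPointedCone]
    let L : (LambdaStar X A → Fin m → ℝ) →ₗ[ℝ] (Fin m → ℝ) := ∑ l, LinearMap.proj l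
    have hLapp : ∀ g, L g = ∑ l, g l := fun g => by simp [L]
    have hDcl : IsClosed (D : Set (LambdaStar X A → Fin m → ℝ)) := by
      have : (D : Set (LambdaStar X A → Fin m → ℝ)) =
          ⋂ l, (fun g => g l) ⁻¹' WitnessCone X A (β l) l := by
        ext g
        simp [hD]
      rw [this]
      exact isClosed_iInter fun l => (isClosed_WitnessCone X A (β l) l).preimage (continuous_apply l)
    have hinj : ∀ g ∈ D, L g = 0 → g = 0 := by
      intro g hg h0
      have hage : ∀ l, g l ∈ AgeCone X A (β l) := fun l =>
        WitnessCone_subset_AgeCone hX (hβ l).1 (hβ1 l) (hβ l).2.2.1 ((hD g).1 hg l)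
      have hzero : ∀ x ∈ X, ∀ l, ∑ i, g l i * Real.exp (dotp (A i) x) = 0 := by
        intro x hx l
        refine (Finset.sum_eq_zero_iff_of_nonneg fun l _ => (hage l).2 x hx).1 ?_ l
          (Finset.mem_univ l)
        rw [Finset.sum_comm]
        refine Finset.sum_eq_zero fun i _ => ?_
        rw [← Finset.sum_mul, ← Finset.sum_apply, ← hLapp, h0, Pi.zero_apply, zero_mul]
      funext l
      exact hLI.eq_zero fun x hx => hzero x hx l
    have hsub := Sage_subset_of_isClosed hX hpoly hm hLI (LambdaStar_nonempty hX hpoly hm hLI hL)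
      (PointedCone.map L D) (isClosed_cone_map L D hDcl hinj) (by
        intro l hl b hb c hc
        have hbb : b = β ⟨l, hl⟩ := by
          by_contra hne
          have := (hβ ⟨l, hl⟩).1.1 b hne
          simp only at this
          linarith
        refine ⟨Pi.single ⟨l, hl⟩ c, (hD _).2 fun l' => ?_, ?_⟩
        · rcases eq_or_ne l' ⟨l, hl⟩ with rfl | hne
          · simpa [← hbb] using hc
          · rw [Pi.single_eq_of_ne hne]
            exact mem_WitnessCone_of_nonneg fun _ => le_rfl
        · exact (hLapp _).trans (by simp))
    intro c hc
    obtain ⟨g, hg, hgc⟩ := hsub hc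
    refine ⟨hfin.toFinset, fun l => if h : l ∈ LambdaStar X A then g ⟨l, h⟩ else 0, by simp,
      fun l hl => ?_, ?_⟩
    · have hl := hfin.mem_toFinset.1 hl
      simp only [dif_pos hl]
      exact Set.mem_iUnion₂.2 ⟨β ⟨l, hl⟩, hβ1 ⟨l, hl⟩, (hD g).1 hg ⟨l, hl⟩⟩
    · have hgc : L g = c := hgc
      rw [← hgc, hLapp, Finset.sum_subtype hfin.toFinset (fun l => hfin.mem_toFinset)]
      exact Finset.sum_congr rfl fun l _ => by simp
  · rintro c ⟨s, f, hs, hf, rfl⟩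
    refine Finset.sum_induction f (· ∈ Sage X A) (fun _ _ => Sage_add) zero_mem_Sage fun l hl => ?_
    obtain ⟨b, hb, hmem⟩ := Set.mem_iUnion₂.1 (hf l hl)
    obtain ⟨b', hcirc, hb'⟩ := Set.mem_iUnion.1 (hs hl).1
    have hbb : b = b' := by
      by_contra hne
      have h1 := hcirc.1.1 b hne
      have h2 : l b = -1 := hb
      linarith
    subst hbb
    exact AgeCone_subset_Sage b
      (WitnessCone_subset_AgeCone hX hcirc.1 hb' hcirc.2.2.1 hmem)

end SageCone

theorem statement10 {n m : ℕ} (X : Set (Fin n → ℝ)) (hXne : X.Nonempty)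
    (hpoly : IsPolyhedron X)
    (A : Fin m → Fin n → ℝ) (hA : Function.Injective A) (hm : 0 < m)
    (hLI : ExpLinIndep X A) (hL : (Lambda X A).Nonempty) :
    (LambdaStar X A).Finite ∧
    Sage X A = MinkSumOver (LambdaStar X A) (WitnessConeL X A) :=
  ⟨LambdaStar_finite hXne hpoly hm hLI, Sage_eq_MinkSumOver hXne hpoly hm hLI hL⟩
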